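/- arXiv:2202.13561 — 3 statements merged into one kernel-verified Lean document; each statement's English description precedes it below -/
import Mathlib

section
/- Let n ≥ 3 be an integer, σ ∈ (0,1), R > 0, p > 0, and let K be a C¹ function on the closed ball of radius 2R in ℝⁿ. Let U be a nonnegative function, continuous on the closed half-ball {X = (x,t) ∈ ℝⁿ × [0,∞) : |X| ≤ 2R}, twice continuously differentiable on the open half-ball B⁺_{2R} = {X = (x,t) : |X| < 2R, t > 0}, and satisfying div(t^{1−2σ} ∇U) = 0 in B⁺_{2R} (equivalently, t ΔU + (1−2σ) ∂_t U = 0 there). Assume that the horizontal gradient ∇ₓU extends continuously to {t = 0}, that t^{1−2σ}|∇U|² is integrable on B⁺_{2R}, and that t^{1−2σ} ∂_t U(x,t) → −K(x) U(x,0)^p as t → 0⁺, locally uniformly in x in the open ball B_{2R} ⊂ ℝⁿ. Then ∫_{B_R} [ ((n−2σ)/2) K(x) U(x,0)^{p+1} + (x · ∇ₓU(x,0)) K(x) U(x,0)^p ] dx + ∫_{∂''B⁺_R} t^{1−2σ} [ ((n−2σ)/2) U ∂U/∂ν − (R/2)|∇U|² + R |∂U/∂ν|² ] dS = 0, where ∂''B⁺_R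 = {X ∈ ℝ^{n+1} : |X| = R, t > 0}, ν = X/R is the outward unit normal, ∂U/∂ν = ⟨∇U, ν⟩, and dS is the n-dimensional surface measure on the sphere of radius R in ℝ^{n+1}. -/
open MeasureTheory Real Set Metric
open scoped RealInnerProductSpace

noncomputable section

/-- The point `(x, t) ∈ ℝ^{n+1}` built from `x ∈ ℝⁿ` and `t ∈ ℝ` (the extension variable is
the last coordinate). -/
def snocE {n : ℕ} (x : EuclideanSpace ℝ (Fin n)) (t : ℝ) :
    EuclideanSpace ℝ (Fin (n + 1)) :=
  (EuclideanSpace.equiv (Fin (n + 1)) ℝ).symm (Fin.snoc (EuclideanSpace.equiv (Fin n) ℝ x) t)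

/-- The Laplacian as the sum of the second partial derivatives in the coordinate directions. -/
def lapl {m : ℕ} (U : EuclideanSpace ℝ (Fin m) → ℝ) (X : EuclideanSpace ℝ (Fin m)) : ℝ :=
  ∑ i, fderiv ℝ (fun Y => fderiv ℝ U Y (EuclideanSpace.single i 1)) X (EuclideanSpace.single i 1)

section Polar

variable {E : Type*} [NormedAddCommGroup E] [NormedSpace ℝ E] [FiniteDimensional ℝ E]
  [Nontrivial E] [MeasurableSpace E] [BorelSpace E] (μ : Measure E) [μ.IsAddHaarMeasure]

instance sigmaFinite_comap_subtypeVal_Ioi :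
    SigmaFinite (Measure.comap Subtype.val volume : Measure (Ioi (0 : ℝ))) := by
  have : (Measure.comap Subtype.val volume : Measure (Ioi (0 : ℝ))) = Measure.volumeIoiPow 0 := by
    simp [Measure.volumeIoiPow]
  rw [this]
  infer_instance

lemma measurePreserving_prodMap_id_subtypeVal {α : Type*} [MeasurableSpace α] (ν : Measure α)
    [SFinite ν] :
    MeasurePreserving (Prod.map id Subtype.val : α × Ioi (0 : ℝ) → α × ℝ)
      (ν.prod (Measure.comap Subtype.val volume)) (ν.prod (volume.restrict (Ioi 0))) :=
  (MeasurePreserving.id ν).prod (measurePreserving_subtype_coe measurableSet_Ioi)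

lemma measurableEmbedding_prodMap_id_subtypeVal {α : Type*} [MeasurableSpace α] :
    MeasurableEmbedding (Prod.map id Subtype.val : α × Ioi (0 : ℝ) → α × ℝ) :=
  MeasurableEmbedding.id.prodMap (MeasurableEmbedding.subtype_coe measurableSet_Ioi)

/-- Integrability in polar coordinates. -/
lemma integrable_iff_integrable_polar {G : E → ℝ} :
    Integrable G μ ↔ Integrable (fun q : sphere (0 : E) 1 × ℝ => q.2 ^ (Module.finrank ℝ E - 1) * G (q.2 • (q.1 : E)))
      (μ.toSphere.prod (volume.restrict (Ioi 0))) := by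
  have h1 := μ.measurePreserving_homeomorphUnitSphereProd.integrable_comp_emb
    (g := fun q : sphere (0 : E) 1 × Ioi (0 : ℝ) => G ((q.2 : ℝ) • (q.1 : E)))
    (Homeomorph.measurableEmbedding _)
  have h2 : (fun q : sphere (0 : E) 1 × Ioi (0 : ℝ) => G ((q.2 : ℝ) • (q.1 : E))) ∘
      (homeomorphUnitSphereProd E) = G ∘ Subtype.val := by
    ext x
    have := homeomorphUnitSphereProd_symm_apply_coe E (homeomorphUnitSphereProd E x)
    simp only [Homeomorph.symm_apply_apply] at this
    exact congrArg G this.symm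
  rw [h2] at h1
  have h3 : Integrable G μ ↔ IntegrableOn G ({0}ᶜ : Set E) μ := by
    rw [IntegrableOn, restrict_compl_singleton]
  rw [h3, integrableOn_iff_comap_subtypeVal (by measurability), h1,
    ← (measurePreserving_prodMap_id_subtypeVal μ.toSphere).integrable_comp_emb
      measurableEmbedding_prodMap_id_subtypeVal, Measure.volumeIoiPow,
    prod_withDensity_right (by fun_prop), integrable_withDensity_iff_integrable_smul']
  · refine integrable_congr (.of_forall ?_)
    rintro ⟨x, r, hr : 0 < r⟩
    simp (disch := positivity) [ENNReal.toReal_ofReal]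
  · fun_prop
  · simp

/-- Integration in polar coordinates. -/
lemma integral_eq_integral_polar (G : E → ℝ) :
    ∫ x, G x ∂μ = ∫ q : sphere (0 : E) 1 × ℝ, q.2 ^ (Module.finrank ℝ E - 1) * G (q.2 • (q.1 : E))
      ∂(μ.toSphere.prod (volume.restrict (Ioi 0))) := by
  have h1 := μ.measurePreserving_homeomorphUnitSphereProd.integral_comp
    (Homeomorph.measurableEmbedding _)
    (fun q : sphere (0 : E) 1 × Ioi (0 : ℝ) => G ((q.2 : ℝ) • (q.1 : E)))
  have h2 : ∀ x : ({0}ᶜ : Set E), (fun q : sphere (0 : E) 1 × Ioi (0 : ℝ) => G ((q.2 : ℝ) • (q.1 : E)))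
      (homeomorphUnitSphereProd E x) = G x := by
    intro x
    have := homeomorphUnitSphereProd_symm_apply_coe E (homeomorphUnitSphereProd E x)
    simp only [Homeomorph.symm_apply_apply] at this
    exact congrArg G this.symm
  simp only [h2] at h1
  have h3 : ∫ x, G x ∂μ = ∫ x in ({0}ᶜ : Set E), G x ∂μ := by
    rw [restrict_compl_singleton]
  rw [h3, ← integral_subtype_comap (measurableSet_singleton _).compl, h1,
    ← (measurePreserving_prodMap_id_subtypeVal μ.toSphere).integral_comp
      measurableEmbedding_prodMap_id_subtypeVal, Measure.volumeIoiPow,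
    prod_withDensity_right (by fun_prop), integral_withDensity_eq_integral_toReal_smul]
  · refine integral_congr_ae (.of_forall ?_)
    rintro ⟨x, r, hr : 0 < r⟩
    simp (disch := positivity) [ENNReal.toReal_ofReal]
  · fun_prop
  · simp

end Polar

section SnocE

variable {n : ℕ}

@[simp]
lemma snocE_last (x : EuclideanSpace ℝ (Fin n)) (t : ℝ) : snocE x t (Fin.last n) = t := by
  simp [snocE]

@[simp]
lemma snocE_castSucc (x : EuclideanSpace ℝ (Fin n)) (t : ℝ) (i : Fin n) :
    snocE x t i.castSucc = x i := by
  simp [snocE]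

lemma norm_snocE_sq (x : EuclideanSpace ℝ (Fin n)) (t : ℝ) :
    ‖snocE x t‖ ^ 2 = ‖x‖ ^ 2 + t ^ 2 := by
  simp [EuclideanSpace.real_norm_sq_eq, Fin.sum_univ_castSucc]

lemma norm_le_norm_snocE (x : EuclideanSpace ℝ (Fin n)) (t : ℝ) : ‖x‖ ≤ ‖snocE x t‖ := by
  have := norm_snocE_sq x t
  exact (sq_le_sq₀ (norm_nonneg _) (norm_nonneg _)).1 (by nlinarith [sq_nonneg t])

lemma norm_snocE_zero (x : EuclideanSpace ℝ (Fin n)) : ‖snocE x 0‖ = ‖x‖ := by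
  have := norm_snocE_sq x 0
  rw [← sq_eq_sq₀ (norm_nonneg _) (norm_nonneg _), this]
  ring

/-- `(x, t) ↦ snocE x t` as a homeomorphism. -/
def snocHomeomorph (n : ℕ) : EuclideanSpace ℝ (Fin n) × ℝ ≃ₜ EuclideanSpace ℝ (Fin (n + 1)) where
  toFun q := snocE q.1 q.2
  invFun X := (WithLp.toLp 2 fun i => X i.castSucc, X (Fin.last n))
  left_inv q := by
    refine Prod.ext ?_ (by simp)
    ext i
    simp
  right_inv X := by
    ext i
    refine Fin.lastCases ?_ (fun i => ?_) i <;> simp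
  continuous_toFun := by
    unfold snocE
    fun_prop
  continuous_invFun := by fun_prop

@[simp]
lemma snocHomeomorph_apply (q : EuclideanSpace ℝ (Fin n) × ℝ) :
    snocHomeomorph n q = snocE q.1 q.2 := rfl

lemma exists_snocE_eq (X : EuclideanSpace ℝ (Fin (n + 1))) : ∃ x t, snocE x t = X :=
  ⟨_, _, (snocHomeomorph n).right_inv X⟩

lemma continuous_snocE : Continuous fun q : EuclideanSpace ℝ (Fin n) × ℝ => snocE q.1 q.2 :=
  (snocHomeomorph n).continuous

lemma measurePreserving_snocE :
    MeasurePreserving (fun q : EuclideanSpace ℝ (Fin n) × ℝ => snocE q.1 q.2) := by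
  have h1 := (volume_preserving_piFinSuccAbove (fun _ : Fin (n + 1) => ℝ) (Fin.last n)).symm
  have h2 : MeasurePreserving (fun q : EuclideanSpace ℝ (Fin n) × ℝ => (q.2, WithLp.ofLp q.1)) :=
    ((MeasurePreserving.id _).prod (PiLp.volume_preserving_ofLp (Fin n))).comp
      Measure.measurePreserving_swap
  have h3 := (PiLp.volume_preserving_toLp (Fin (n + 1))).comp (h1.comp h2)
  convert h3 using 1
  ext q i
  refine Fin.lastCases ?_ (fun i => ?_) i <;> simp [MeasurableEquiv.piFinSuccAbove_symm_apply]

lemma measurableEmbedding_snocE :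
    MeasurableEmbedding (fun q : EuclideanSpace ℝ (Fin n) × ℝ => snocE q.1 q.2) :=
  (snocHomeomorph n).measurableEmbedding

end SnocE

section WeakDivergence

variable {E : Type*} [NormedAddCommGroup E] [NormedSpace ℝ E] [FiniteDimensional ℝ E]
  [MeasurableSpace E] [BorelSpace E] (μ : Measure E) [μ.IsAddHaarMeasure]

/-- Integration by parts against a test function supported in the open set where `f` is `C¹`. -/
lemma integral_fderiv_mul_eq_neg_of_tsupport_subset {Ω : Set E} (hΩ : IsOpen Ω) {f ψ : E → ℝ}
    (hf : ContDiffOn ℝ 1 f Ω) (hψ : ContDiff ℝ 1 ψ) (hc : HasCompactSupport ψ)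
    (hs : tsupport ψ ⊆ Ω) (v : E) :
    Integrable (fun x => fderiv ℝ ψ x v * f x) μ ∧ Integrable (fun x => ψ x * fderiv ℝ f x v) μ ∧
    ∫ x, ψ x * fderiv ℝ f x v ∂μ = - ∫ x, fderiv ℝ ψ x v * f x ∂μ := by
  have hfc : ∀ x ∈ tsupport ψ, ContinuousAt f x := fun x hx =>
    hf.continuousOn.continuousAt (hΩ.mem_nhds (hs hx))
  have hf'c : ∀ x ∈ tsupport ψ, ContinuousAt (fun x => fderiv ℝ f x v) x := fun x hx =>
    (((hf.continuousOn_fderiv_of_isOpen hΩ le_rfl).continuousAt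
      (hΩ.mem_nhds (hs hx))).clm_apply continuousAt_const)
  have hψ' : Continuous fun x => fderiv ℝ ψ x v := (hψ.continuous_fderiv one_ne_zero).clm_apply
    continuous_const
  have hcψ' : HasCompactSupport fun x => fderiv ℝ ψ x v := hc.fderiv_apply (𝕜 := ℝ) v
  have hsub : tsupport (fun x => fderiv ℝ ψ x v) ⊆ tsupport ψ := tsupport_fderiv_apply_subset ℝ v
  have i1 : Integrable (fun x => fderiv ℝ ψ x v * f x) μ := by
    refine (continuous_of_tsupport fun x hx => ?_).integrable_of_hasCompactSupport hcψ'.mul_right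
    exact hψ'.continuousAt.mul (hfc x (hsub (tsupport_mul_subset_left hx)))
  have i2 : Integrable (fun x => ψ x * fderiv ℝ f x v) μ := by
    refine (continuous_of_tsupport fun x hx => ?_).integrable_of_hasCompactSupport hc.mul_right
    exact hψ.continuous.continuousAt.mul (hf'c x (tsupport_mul_subset_left hx))
  have i3 : Integrable (fun x => ψ x * f x) μ := by
    refine (continuous_of_tsupport fun x hx => ?_).integrable_of_hasCompactSupport hc.mul_right
    exact hψ.continuous.continuousAt.mul (hfc x (tsupport_mul_subset_left hx))
  refine ⟨i1, i2, integral_mul_fderiv_eq_neg_fderiv_mul_of_integrable i1 i2 i3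
    (fun x _ => hψ.differentiable one_ne_zero x) fun x hx => ?_⟩
  exact (hf.contDiffAt (hΩ.mem_nhds (hs hx))).differentiableAt one_ne_zero

/-- A `C¹` divergence-free field is weakly divergence-free. -/
lemma integral_fderiv_apply_eq_zero_of_div_eq_zero {m : ℕ} {Ω : Set (EuclideanSpace ℝ (Fin m))}
    (hΩ : IsOpen Ω) {F : EuclideanSpace ℝ (Fin m) → EuclideanSpace ℝ (Fin m)}
    (hF : ∀ i, ContDiffOn ℝ 1 (fun X => F X i) Ω)
    (hdiv : ∀ X ∈ Ω, ∑ i, fderiv ℝ (fun Y => F Y i) X (EuclideanSpace.single i 1) = 0)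
    {ψ : EuclideanSpace ℝ (Fin m) → ℝ} (hψ : ContDiff ℝ 1 ψ) (hc : HasCompactSupport ψ)
    (hs : tsupport ψ ⊆ Ω) :
    ∫ X, fderiv ℝ ψ X (F X) = 0 := by
  have key := fun i => integral_fderiv_mul_eq_neg_of_tsupport_subset volume hΩ (hF i) hψ hc hs
    (EuclideanSpace.single i 1)
  have h1 : ∀ X, fderiv ℝ ψ X (F X) =
      ∑ i, fderiv ℝ ψ X (EuclideanSpace.single i 1) * F X i := by
    intro X
    conv_lhs => rw [← (EuclideanSpace.basisFun (Fin m) ℝ).sum_repr (F X)]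
    simp [mul_comm]
  simp_rw [h1]
  rw [integral_finsetSum _ fun i _ => (key i).1]
  have h2 : ∀ i, ∫ X, fderiv ℝ ψ X (EuclideanSpace.single i 1) * F X i =
      -∫ X, ψ X * fderiv ℝ (fun Y => F Y i) X (EuclideanSpace.single i 1) := fun i => by
    rw [(key i).2.2, neg_neg]
  simp_rw [h2]
  rw [Finset.sum_neg_distrib, ← integral_finsetSum _ fun i _ => (key i).2.1, neg_eq_zero]
  refine integral_eq_zero_of_ae (.of_forall fun X => ?_)
  simp only [← Finset.mul_sum, Pi.zero_apply, mul_eq_zero]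
  by_cases hX : X ∈ Ω
  · exact Or.inr (hdiv X hX)
  · exact Or.inl (image_eq_zero_of_notMem_tsupport fun h => hX (hs h))

end WeakDivergence

section Cutoff

/-- A smooth cutoff, equal to `0` on `(-∞, ε]` and to `1` on `[2ε, ∞)`. -/
def smoothCutoff (ε t : ℝ) : ℝ := Real.smoothTransition (t / ε - 1)

variable {ε t : ℝ}

lemma contDiff_smoothCutoff (ε : ℝ) : ContDiff ℝ 1 (smoothCutoff ε) :=
  Real.smoothTransition.contDiff.comp ((contDiff_id.div_const ε).sub contDiff_const)

lemma smoothCutoff_nonneg (ε t : ℝ) : 0 ≤ smoothCutoff ε t := Real.smoothTransition.nonneg _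

lemma smoothCutoff_le_one (ε t : ℝ) : smoothCutoff ε t ≤ 1 := Real.smoothTransition.le_one _

lemma smoothCutoff_of_le (hε : 0 < ε) (ht : t ≤ ε) : smoothCutoff ε t = 0 :=
  Real.smoothTransition.zero_of_nonpos (by rw [sub_nonpos, div_le_one hε]; exact ht)

lemma smoothCutoff_of_two_mul_le (hε : 0 < ε) (ht : 2 * ε ≤ t) : smoothCutoff ε t = 1 :=
  Real.smoothTransition.one_of_one_le (by
    rw [le_sub_iff_add_le, le_div_iff₀ hε]; linarith)

lemma deriv_smoothCutoff_nonneg (hε : 0 < ε) (t : ℝ) : 0 ≤ deriv (smoothCutoff ε) t := by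
  refine Monotone.deriv_nonneg fun a b hab => Real.smoothTransition.monotone ?_
  gcongr

lemma deriv_smoothCutoff_of_le (hε : 0 < ε) (ht : t ≤ ε) : deriv (smoothCutoff ε) t = 0 :=
  IsLocalMin.deriv_eq_zero (.of_forall fun s => by
    rw [smoothCutoff_of_le hε ht]; exact smoothCutoff_nonneg ε s)

lemma deriv_smoothCutoff_of_two_mul_le (hε : 0 < ε) (ht : 2 * ε ≤ t) :
    deriv (smoothCutoff ε) t = 0 :=
  IsLocalMax.deriv_eq_zero (.of_forall fun s => by
    rw [smoothCutoff_of_two_mul_le hε ht]; exact smoothCutoff_le_one ε s)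

lemma continuous_deriv_smoothCutoff (ε : ℝ) : Continuous (deriv (smoothCutoff ε)) :=
  (contDiff_smoothCutoff ε).continuous_deriv_one

lemma hasCompactSupport_deriv_smoothCutoff (hε : 0 < ε) :
    HasCompactSupport (deriv (smoothCutoff ε)) := by
  refine HasCompactSupport.intro (isCompact_Icc (a := ε) (b := 2 * ε)) fun t ht => ?_
  rcases lt_or_ge t ε with h | h
  · exact deriv_smoothCutoff_of_le hε h.le
  · exact deriv_smoothCutoff_of_two_mul_le hε (le_of_lt (by
      by_contra! h'
      exact ht ⟨h, h'⟩))

lemma integrable_deriv_smoothCutoff (hε : 0 < ε) : Integrable (deriv (smoothCutoff ε)) :=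
  (continuous_deriv_smoothCutoff ε).integrable_of_hasCompactSupport
    (hasCompactSupport_deriv_smoothCutoff hε)

lemma integral_deriv_smoothCutoff (hε : 0 < ε) : ∫ t, deriv (smoothCutoff ε) t = 1 := by
  rw [integral_of_hasDerivAt_of_tendsto
    (fun t => ((contDiff_smoothCutoff ε).differentiable one_ne_zero t).hasDerivAt)
    (integrable_deriv_smoothCutoff hε) (m := 0) (n := 1), sub_zero]
  · exact tendsto_const_nhds.congr' ((Filter.eventually_le_atBot ε).mono fun t ht =>
      (smoothCutoff_of_le hε ht).symm)
  · exact tendsto_const_nhds.congr' ((Filter.eventually_ge_atTop (2 * ε)).mono fun t ht =>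
      (smoothCutoff_of_two_mul_le hε ht).symm)

lemma tendsto_smoothCutoff (ht : 0 < t) :
    Filter.Tendsto (fun ε => smoothCutoff ε t) (nhdsWithin 0 (Ioi 0)) (nhds 1) := by
  refine tendsto_const_nhds.congr' ?_
  filter_upwards [Ioo_mem_nhdsGT (half_pos ht)] with ε hε
  exact (smoothCutoff_of_two_mul_le hε.1 (by linarith [hε.2])).symm

/-- The derivatives of the cutoffs form an approximate identity concentrating at `0⁺`. -/
lemma tendsto_integral_deriv_smoothCutoff_mul {G : ℝ → ℝ} {G₀ : ℝ}
    (hG : Filter.Tendsto G (nhdsWithin 0 (Ioi 0)) (nhds G₀))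
    (hint : ∀ ε, 0 < ε → Integrable fun t => deriv (smoothCutoff ε) t * G t) :
    Filter.Tendsto (fun ε => ∫ t, deriv (smoothCutoff ε) t * G t) (nhdsWithin 0 (Ioi 0))
      (nhds G₀) := by
  rw [Metric.tendsto_nhds] at hG ⊢
  intro δ hδ
  obtain ⟨τ, hτ, hτG⟩ := (mem_nhdsGT_iff_exists_Ioo_subset).1 (hG (δ / 2) (half_pos hδ))
  filter_upwards [Ioo_mem_nhdsGT (half_pos hτ)] with ε hε
  have hε0 : 0 < ε := hε.1
  have h1 : (∫ t, deriv (smoothCutoff ε) t * G t) - G₀ =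
      ∫ t, deriv (smoothCutoff ε) t * (G t - G₀) := by
    simp_rw [mul_sub]
    rw [integral_sub (hint ε hε0) ((integrable_deriv_smoothCutoff hε0).mul_const _),
      integral_mul_const, integral_deriv_smoothCutoff hε0, one_mul]
  rw [Real.dist_eq, h1, ← Real.norm_eq_abs]
  have h2 : ‖∫ t, deriv (smoothCutoff ε) t * (G t - G₀)‖ ≤
      ∫ t, deriv (smoothCutoff ε) t * (δ / 2) := by
    refine norm_integral_le_of_norm_le ((integrable_deriv_smoothCutoff hε0).mul_const _)
      (.of_forall fun t => ?_)
    rw [norm_mul, Real.norm_of_nonneg (deriv_smoothCutoff_nonneg hε0 t)]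
    by_cases ht : t ∈ Ioo 0 τ
    · exact mul_le_mul_of_nonneg_left (hτG ht).le (deriv_smoothCutoff_nonneg hε0 t)
    · have : deriv (smoothCutoff ε) t = 0 := by
        rcases le_or_gt t ε with h | h
        · exact deriv_smoothCutoff_of_le hε0 h
        · refine deriv_smoothCutoff_of_two_mul_le hε0 ?_
          by_contra! h'
          exact ht ⟨hε0.trans h, by linarith [hε.2]⟩
      simp [this]
  rw [integral_mul_const, integral_deriv_smoothCutoff hε0, one_mul] at h2
  linarith

end Cutoff

section HalfSpace

variable {n : ℕ}

lemma measurableSet_last_pos :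
    MeasurableSet {X : EuclideanSpace ℝ (Fin (n + 1)) | 0 < X (Fin.last n)} :=
  (isOpen_lt continuous_const (by fun_prop)).measurableSet

lemma integral_eq_integral_integral_snocE {h : EuclideanSpace ℝ (Fin (n + 1)) → ℝ}
    (hh : Integrable h) : ∫ X, h X = ∫ t, ∫ x, h (snocE x t) := by
  rw [← measurePreserving_snocE.integral_comp measurableEmbedding_snocE]
  exact integral_prod_symm _ ((measurePreserving_snocE.integrable_comp_emb
    measurableEmbedding_snocE).2 hh)

lemma integrable_deriv_smoothCutoff_last_mul
    {k : EuclideanSpace ℝ (Fin (n + 1)) → ℝ} {r ε : ℝ} (hε : 0 < ε)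
    (hk : ContinuousOn k {X | 0 < X (Fin.last n)})
    (hr : ∀ X : EuclideanSpace ℝ (Fin (n + 1)), r ≤ ‖X‖ → k X = 0) :
    Integrable fun X : EuclideanSpace ℝ (Fin (n + 1)) =>
      deriv (smoothCutoff ε) (X (Fin.last n)) * k X := by
  have hopen : IsOpen {X : EuclideanSpace ℝ (Fin (n + 1)) | 0 < X (Fin.last n)} :=
    isOpen_lt continuous_const (by fun_prop)
  have hsub : tsupport (fun X : EuclideanSpace ℝ (Fin (n + 1)) =>
      deriv (smoothCutoff ε) (X (Fin.last n)) * k X) ⊆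
      {X | ε ≤ X (Fin.last n)} ∩ closedBall 0 r := by
    refine closure_minimal (fun X hX => ⟨?_, ?_⟩)
      ((isClosed_le continuous_const (by fun_prop)).inter isClosed_closedBall)
    · by_contra h
      exact hX (by simp [deriv_smoothCutoff_of_le hε (le_of_not_ge h)])
    · by_contra h
      rw [mem_closedBall_zero_iff, not_le] at h
      exact hX (by simp [hr X h.le])
  refine Continuous.integrable_of_hasCompactSupport (continuous_of_tsupport fun X hX => ?_) ?_
  · refine ContinuousAt.mul ?_ (hk.continuousAt (hopen.mem_nhds (hε.trans_le (hsub hX).1)))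
    exact ((continuous_deriv_smoothCutoff ε).comp (by fun_prop :
      Continuous fun X : EuclideanSpace ℝ (Fin (n + 1)) => X (Fin.last n))).continuousAt
  · exact (isCompact_closedBall _ _).of_isClosed_subset (isClosed_tsupport _)
      (hsub.trans inter_subset_right)

/-- The boundary trace on `{t = 0}` is the limit of integrals against the derivative of the
cutoff in `t`. -/
lemma tendsto_integral_deriv_smoothCutoff_last_mul
    {k : EuclideanSpace ℝ (Fin (n + 1)) → ℝ} {k₀ : EuclideanSpace ℝ (Fin n) → ℝ} {r C : ℝ}
    (hk : ContinuousOn k {X | 0 < X (Fin.last n)})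
    (hC : ∀ X : EuclideanSpace ℝ (Fin (n + 1)), 0 < X (Fin.last n) → |k X| ≤ C)
    (hr : ∀ X : EuclideanSpace ℝ (Fin (n + 1)), r ≤ ‖X‖ → k X = 0)
    (hlim : ∀ x, Filter.Tendsto (fun t => k (snocE x t)) (nhdsWithin 0 (Ioi 0)) (nhds (k₀ x))) :
    Filter.Tendsto (fun ε => ∫ X : EuclideanSpace ℝ (Fin (n + 1)),
      deriv (smoothCutoff ε) (X (Fin.last n)) * k X) (nhdsWithin 0 (Ioi 0))
      (nhds (∫ x, k₀ x)) := by
  have hint : ∀ ε, 0 < ε → Integrable fun X : EuclideanSpace ℝ (Fin (n + 1)) =>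
      deriv (smoothCutoff ε) (X (Fin.last n)) * k X := fun ε hε =>
    integrable_deriv_smoothCutoff_last_mul hε hk hr
  have hG : Filter.Tendsto (fun t => ∫ x, k (snocE x t)) (nhdsWithin 0 (Ioi 0))
      (nhds (∫ x, k₀ x)) := by
    refine tendsto_integral_filter_of_dominated_convergence
      ((closedBall 0 r).indicator fun _ => C) ?_ ?_ ?_ (.of_forall hlim)
    · filter_upwards [self_mem_nhdsWithin] with t ht
      refine Continuous.aestronglyMeasurable ?_
      exact hk.comp_continuous (continuous_snocE.comp (by fun_prop : Continuous fun x => (x, t)))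
        (fun x => by simpa using ht)
    · filter_upwards [self_mem_nhdsWithin] with t ht
      refine .of_forall fun x => ?_
      by_cases hx : x ∈ closedBall (0 : EuclideanSpace ℝ (Fin n)) r
      · simpa [indicator_of_mem hx] using hC (snocE x t) (by simpa using ht)
      · rw [indicator_of_notMem hx, hr, norm_zero]
        rw [mem_closedBall_zero_iff, not_le] at hx
        exact hx.le.trans (norm_le_norm_snocE x t)
    · exact (integrable_indicator_iff measurableSet_closedBall).2
        (integrableOn_const measure_closedBall_lt_top.ne)
  refine (tendsto_integral_deriv_smoothCutoff_mul hG fun ε hε => ?_).congr' ?_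
  · have := ((measurePreserving_snocE.integrable_comp_emb
      measurableEmbedding_snocE).2 (hint ε hε)).integral_prod_right
    simpa [Function.comp_def, integral_const_mul] using this
  · filter_upwards [self_mem_nhdsWithin] with ε hε
    rw [integral_eq_integral_integral_snocE (hint ε hε)]
    simp [integral_const_mul]

end HalfSpace

section Flux

variable {n : ℕ}

/-- The open half-ball of radius `ρ`. -/
def halfBall (n : ℕ) (ρ : ℝ) : Set (EuclideanSpace ℝ (Fin (n + 1))) :=
  {X | ‖X‖ < ρ ∧ 0 < X (Fin.last n)}

lemma isOpen_halfBall (ρ : ℝ) : IsOpen (halfBall n ρ) :=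
  (isOpen_lt continuous_norm continuous_const).inter
    (isOpen_lt continuous_const (EuclideanSpace.proj (𝕜 := ℝ) (Fin.last n)).continuous)

lemma abs_last_le_norm (X : EuclideanSpace ℝ (Fin (n + 1))) : |X (Fin.last n)| ≤ ‖X‖ :=
  PiLp.norm_apply_le X (Fin.last n)

lemma integrableOn_last_rpow {b : ℝ} (hb : -1 < b) (r : ℝ) :
    IntegrableOn (fun X : EuclideanSpace ℝ (Fin (n + 1)) => X (Fin.last n) ^ b)
      (halfBall n r) := by
  have h1 : Integrable ((ball (0 : EuclideanSpace ℝ (Fin n)) r).indicator fun _ => (1 : ℝ)) :=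
    (integrable_indicator_iff measurableSet_ball).2 (integrableOn_const measure_ball_lt_top.ne)
  have h2 : Integrable ((Ioo 0 r).indicator fun t : ℝ => t ^ b) := by
    rw [integrable_indicator_iff measurableSet_Ioo]
    rcases le_or_gt r 0 with hr | hr
    · simp [Ioo_eq_empty (not_lt.2 hr)]
    · exact (intervalIntegral.integrableOn_Ioo_rpow_iff hr).2 hb
  have h3 := h1.mul_prod h2
  rw [← integrable_indicator_iff (isOpen_halfBall r).measurableSet,
    ← measurePreserving_snocE.integrable_comp_emb measurableEmbedding_snocE]
  refine h3.mono' ?_ (.of_forall fun q => ?_)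
  · refine Measurable.aestronglyMeasurable ?_
    refine Measurable.comp (Measurable.indicator ?_ (isOpen_halfBall r).measurableSet)
      continuous_snocE.measurable
    fun_prop
  · by_cases hq : snocE q.1 q.2 ∈ halfBall n r
    · have ht : 0 < q.2 := by simpa using hq.2
      have ht' : q.2 < r := by
        have := abs_last_le_norm (snocE q.1 q.2)
        rw [snocE_last] at this
        exact (le_abs_self _).trans_lt (this.trans_lt hq.1)
      have hx : q.1 ∈ ball (0 : EuclideanSpace ℝ (Fin n)) r := by
        rw [mem_ball_zero_iff]
        exact (norm_le_norm_snocE _ _).trans_lt hq.1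
      simp [Function.comp, indicator_of_mem hq, indicator_of_mem hx,
        indicator_of_mem (show q.2 ∈ Ioo 0 r from ⟨ht, ht'⟩), abs_of_nonneg (rpow_nonneg ht.le b)]
    · simp only [Function.comp, indicator_of_notMem hq, norm_zero]
      exact mul_nonneg (indicator_nonneg (fun _ _ => zero_le_one) _)
        (indicator_nonneg (fun t ht => rpow_nonneg ht.1.le _) _)

lemma integrableOn_sphere_last_rpow {b : ℝ} (hb : -1 < b) :
    IntegrableOn (fun ω : sphere (0 : EuclideanSpace ℝ (Fin (n + 1))) 1 =>
      (ω : EuclideanSpace ℝ (Fin (n + 1))) (Fin.last n) ^ b)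
      {ω | 0 < (ω : EuclideanSpace ℝ (Fin (n + 1))) (Fin.last n)}
      (volume : Measure (EuclideanSpace ℝ (Fin (n + 1)))).toSphere := by
  have h1 := (integrable_iff_integrable_polar volume).1
    ((integrable_indicator_iff (isOpen_halfBall 1).measurableSet).2
      (integrableOn_last_rpow (n := n) hb 1))
  have h2 : ∀ᵐ r ∂(volume.restrict (Ioo (0 : ℝ) 1)), r ∈ Ioo (0 : ℝ) 1 ∧ Integrable
      (fun ω : sphere (0 : EuclideanSpace ℝ (Fin (n + 1))) 1 =>
        r ^ (Module.finrank ℝ (EuclideanSpace ℝ (Fin (n + 1))) - 1) * (halfBall n 1).indicator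
        (fun X : EuclideanSpace ℝ (Fin (n + 1)) => X (Fin.last n) ^ b) (r • (ω : _)))
      (volume : Measure (EuclideanSpace ℝ (Fin (n + 1)))).toSphere :=
    (ae_restrict_mem measurableSet_Ioo).and
      (ae_mono (Measure.restrict_mono Ioo_subset_Ioi_self le_rfl) h1.prod_left_ae)
  have : (ae (volume.restrict (Ioo (0 : ℝ) 1))).NeBot := by
    rw [ae_neBot, Ne, Measure.restrict_eq_zero]
    simp
  obtain ⟨r, hr, hint⟩ := h2.exists
  have hS : MeasurableSet {ω : sphere (0 : EuclideanSpace ℝ (Fin (n + 1))) 1 |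
      0 < (ω : EuclideanSpace ℝ (Fin (n + 1))) (Fin.last n)} :=
    (isOpen_lt continuous_const (by fun_prop)).measurableSet
  rw [← integrable_indicator_iff hS]
  refine (hint.const_mul
    (r ^ (Module.finrank ℝ (EuclideanSpace ℝ (Fin (n + 1))) - 1) * r ^ b)⁻¹).congr
    (.of_forall fun ω => ?_)
  have hr0 := hr.1
  have hmem : r • (ω : EuclideanSpace ℝ (Fin (n + 1))) ∈ halfBall n 1 ↔
      0 < (ω : EuclideanSpace ℝ (Fin (n + 1))) (Fin.last n) := by
    simp [halfBall, norm_smul, abs_of_pos hr0, hr.2, hr0]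
  by_cases hω : 0 < (ω : EuclideanSpace ℝ (Fin (n + 1))) (Fin.last n)
  · have := rpow_pos_of_pos hr0 b
    simp only [indicator_of_mem (hmem.2 hω), PiLp.smul_apply, smul_eq_mul]
    rw [indicator_of_mem (by exact hω), mul_rpow hr0.le hω.le]
    field_simp
  · simp only [indicator_of_notMem (mt hmem.1 hω)]
    rw [indicator_of_notMem (by exact hω)]
    simp

/-- The weak form of `div F = 0` for a test function that is the product of a radial function and a
cutoff in the last variable. -/
lemma integral_radial_mul_cutoff_eq_zero {ρ r₁ ε : ℝ} (hr₁ : r₁ < ρ) (hε : 0 < ε)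
    {F : EuclideanSpace ℝ (Fin (n + 1)) → EuclideanSpace ℝ (Fin (n + 1))}
    (hF : ∀ i, ContDiffOn ℝ 1 (fun X => F X i) (halfBall n ρ))
    (hdiv : ∀ X ∈ halfBall n ρ,
      ∑ i, fderiv ℝ (fun Y => F Y i) X (EuclideanSpace.single i 1) = 0)
    {η : ℝ → ℝ} (hη : ContDiff ℝ 1 η) (hη0 : ∀ r, r₁ ≤ r → η r = 0) :
    ∫ X : EuclideanSpace ℝ (Fin (n + 1)), (smoothCutoff ε (X (Fin.last n)) *
        (deriv η ‖X‖ * (⟪X, F X⟫ / ‖X‖)) +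
      deriv (smoothCutoff ε) (X (Fin.last n)) * (η ‖X‖ * F X (Fin.last n))) = 0 := by
  set ψ : EuclideanSpace ℝ (Fin (n + 1)) → ℝ :=
    fun X => η ‖X‖ * smoothCutoff ε (X (Fin.last n)) with hψdef
  have hlast : ContDiff ℝ 1 fun X : EuclideanSpace ℝ (Fin (n + 1)) => X (Fin.last n) := by
    fun_prop
  have hzero : ∀ X : EuclideanSpace ℝ (Fin (n + 1)), X (Fin.last n) < ε → ψ =ᶠ[nhds X] 0 := by
    intro X hX
    filter_upwards [(isOpen_lt (by fun_prop : Continuous fun X : EuclideanSpace ℝ (Fin (n + 1)) =>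
      X (Fin.last n)) continuous_const).mem_nhds hX] with Y hY
    simp [hψdef, smoothCutoff_of_le hε (le_of_lt hY)]
  have hne : ∀ X : EuclideanSpace ℝ (Fin (n + 1)), ¬ X (Fin.last n) < ε → X ≠ 0 := by
    rintro X hX rfl
    exact hX (by simpa using hε)
  have hψ : ContDiff ℝ 1 ψ := by
    rw [contDiff_iff_contDiffAt]
    intro X
    by_cases hX : X (Fin.last n) < ε
    · exact (contDiffAt_const (c := (0 : ℝ))).congr_of_eventuallyEq (hzero X hX)
    · exact (hη.contDiffAt.comp X (contDiffAt_norm ℝ (hne X hX))).mul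
        ((contDiff_smoothCutoff ε).comp hlast).contDiffAt
  have hsub : tsupport ψ ⊆ {X | ε ≤ X (Fin.last n)} ∩ closedBall 0 r₁ := by
    refine closure_minimal (fun X hX => ⟨?_, ?_⟩)
      ((isClosed_le continuous_const (by fun_prop)).inter isClosed_closedBall)
    · by_contra h
      exact hX (by simp [hψdef, smoothCutoff_of_le hε (le_of_not_ge h)])
    · by_contra h
      rw [mem_closedBall_zero_iff, not_le] at h
      exact hX (by simp [hψdef, hη0 _ h.le])
  have hc : HasCompactSupport ψ := (isCompact_closedBall _ _).of_isClosed_subset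
    (isClosed_tsupport _) (hsub.trans inter_subset_right)
  rw [← integral_fderiv_apply_eq_zero_of_div_eq_zero (isOpen_halfBall ρ) hF hdiv hψ hc
    fun X hX => ⟨(mem_closedBall_zero_iff.1 (hsub hX).2).trans_lt hr₁, hε.trans_le (hsub hX).1⟩]
  congr 1
  ext X
  by_cases hX : X (Fin.last n) < ε
  · rw [(hzero X hX).fderiv_eq, smoothCutoff_of_le hε hX.le, deriv_smoothCutoff_of_le hε hX.le]
    simp
  · have hX0 := hne X hX
    have h1 : HasFDerivAt (fun X : EuclideanSpace ℝ (Fin (n + 1)) => ‖X‖)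
        ((‖X‖⁻¹) • innerSL ℝ X) X := by
      have h := (hasStrictFDerivAt_norm_sq X).hasFDerivAt.sqrt (by positivity)
      simp only [norm_nonneg, Real.sqrt_sq] at h
      refine h.congr_fderiv ?_
      ext v
      simp
      field_simp
    have h2 := ((hη.differentiable one_ne_zero _).hasDerivAt (x := ‖X‖)).comp_hasFDerivAt X h1
    have h3 := (((contDiff_smoothCutoff ε).differentiable one_ne_zero _).hasDerivAt
      (x := X (Fin.last n))).comp_hasFDerivAt X
      ((hlast.differentiable one_ne_zero X).hasFDerivAt)
    have h4 : fderiv ℝ (fun X : EuclideanSpace ℝ (Fin (n + 1)) => X (Fin.last n)) X (F X) =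
        F X (Fin.last n) := by
      have := (EuclideanSpace.proj (𝕜 := ℝ) (Fin.last n)).hasFDerivAt (x := X)
      exact congrArg (fun L => L (F X)) this.fderiv
    have h5 := (h2.mul h3).fderiv
    have h6 : fderiv ℝ ψ X = _ := h5
    rw [h6]
    simp only [add_apply, smul_apply, h4, smul_eq_mul,
      innerSL_apply_apply, Function.comp]
    ring

end Flux

section FluxIdentity

variable {n : ℕ}

lemma continuousOn_of_forall_apply {m : ℕ} {X : Type*} [TopologicalSpace X] {s : Set X}
    {F : X → EuclideanSpace ℝ (Fin m)} (hF : ∀ i, ContinuousOn (fun x => F x i) s) :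
    ContinuousOn F s :=
  (PiLp.continuous_toLp 2 (fun _ : Fin m => ℝ)).comp_continuousOn (continuousOn_pi.2 hF)

lemma integrable_radial_flux {ρ r₁ b : ℝ} (hr₁ : r₁ < ρ) (hb : -1 < b)
    {F : EuclideanSpace ℝ (Fin (n + 1)) → EuclideanSpace ℝ (Fin (n + 1))}
    (hF : ContinuousOn F (halfBall n ρ))
    (hbound : ∀ r < ρ, ∃ C, ∀ X : EuclideanSpace ℝ (Fin (n + 1)), ‖X‖ ≤ r → 0 < X (Fin.last n) →
      ‖F X‖ ≤ C * X (Fin.last n) ^ b)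
    {θ : ℝ → ℝ} (hθ : Continuous θ) (hθ0 : ∀ r, r₁ < r → θ r = 0) :
    Integrable ((halfBall n ρ).indicator fun X => θ ‖X‖ * (⟪X, F X⟫ / ‖X‖)) := by
  obtain ⟨C, hC⟩ := hbound r₁ hr₁
  obtain ⟨M, hM⟩ := isCompact_Icc.exists_bound_of_continuousOn (hθ.continuousOn (s := Icc 0 r₁))
  rw [integrable_indicator_iff (isOpen_halfBall ρ).measurableSet]
  refine Integrable.mono' ((integrableOn_last_rpow hb ρ).const_mul (|M| * |C|)) ?_ ?_
  · refine ContinuousOn.aestronglyMeasurable ?_ (isOpen_halfBall ρ).measurableSet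
    refine (hθ.comp continuous_norm).continuousOn.mul
      ((continuousOn_id.inner hF).div continuous_norm.continuousOn fun X hX => ?_)
    rintro h0
    rw [norm_eq_zero] at h0
    have := hX.2
    simp [h0] at this
  · filter_upwards [ae_restrict_mem (isOpen_halfBall ρ).measurableSet] with X hX
    have hpos : 0 ≤ X (Fin.last n) ^ b := rpow_nonneg hX.2.le _
    rcases le_or_gt ‖X‖ r₁ with h | h
    · have h1 := hM ‖X‖ ⟨norm_nonneg _, h⟩
      have h2 := hC X h hX.2
      have h3 : ‖⟪X, F X⟫ / ‖X‖‖ ≤ ‖F X‖ := by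
        rw [norm_div, norm_norm]
        exact div_le_of_le_mul₀ (norm_nonneg _) (norm_nonneg _)
          ((norm_inner_le_norm X (F X)).trans_eq (mul_comm _ _))
      rw [norm_mul, mul_assoc]
      exact mul_le_mul (h1.trans (le_abs_self M))
        (h3.trans (h2.trans (mul_le_mul_of_nonneg_right (le_abs_self C) hpos)))
        (norm_nonneg _) (abs_nonneg M)
    · rw [hθ0 _ h, zero_mul, norm_zero]
      positivity

lemma integral_radial_flux_add_integral_eq_zero {ρ r₁ b : ℝ} (hr₁ : r₁ < ρ) (hb : -1 < b)
    {F : EuclideanSpace ℝ (Fin (n + 1)) → EuclideanSpace ℝ (Fin (n + 1))}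
    {f₀ : EuclideanSpace ℝ (Fin n) → ℝ}
    (hF : ∀ i, ContDiffOn ℝ 1 (fun X => F X i) (halfBall n ρ))
    (hdiv : ∀ X ∈ halfBall n ρ,
      ∑ i, fderiv ℝ (fun Y => F Y i) X (EuclideanSpace.single i 1) = 0)
    (hbound : ∀ r < ρ, ∃ C, ∀ X : EuclideanSpace ℝ (Fin (n + 1)), ‖X‖ ≤ r → 0 < X (Fin.last n) →
      ‖F X‖ ≤ C * X (Fin.last n) ^ b)
    (hbound' : ∀ r < ρ, ∃ C, ∀ X : EuclideanSpace ℝ (Fin (n + 1)), ‖X‖ ≤ r → 0 < X (Fin.last n) →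
      |F X (Fin.last n)| ≤ C)
    (hlim : ∀ x ∈ ball (0 : EuclideanSpace ℝ (Fin n)) ρ, Filter.Tendsto
      (fun t => F (snocE x t) (Fin.last n)) (nhdsWithin 0 (Ioi 0)) (nhds (f₀ x)))
    {η : ℝ → ℝ} (hη : ContDiff ℝ 1 η) (hη0 : ∀ r, r₁ ≤ r → η r = 0) :
    (∫ X, (halfBall n ρ).indicator (fun X => deriv η ‖X‖ * (⟪X, F X⟫ / ‖X‖)) X) +
      ∫ x, η ‖x‖ * f₀ x = 0 := by
  have hη'0 : ∀ r, r₁ < r → deriv η r = 0 := fun r hr => by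
    rw [Filter.EventuallyEq.deriv_eq (f := fun _ => (0 : ℝ)), deriv_const]
    filter_upwards [Ioi_mem_nhds hr] with s hs using hη0 s hs.le
  set d := (halfBall n ρ).indicator fun X => deriv η ‖X‖ * (⟪X, F X⟫ / ‖X‖) with hd
  have hdint : Integrable d := integrable_radial_flux hr₁ hb
    (continuousOn_of_forall_apply fun i => (hF i).continuousOn) hbound hη.continuous_deriv_one hη'0
  set k : EuclideanSpace ℝ (Fin (n + 1)) → ℝ := fun X => η ‖X‖ * F X (Fin.last n) with hk
  have hk0 : ∀ X, r₁ ≤ ‖X‖ → k X = 0 := fun X hX => by simp [hk, hη0 _ hX]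
  have hkc : ContinuousOn k {X | 0 < X (Fin.last n)} := by
    intro X hX
    rcases lt_or_ge ‖X‖ ρ with h | h
    · exact ((hη.continuous.comp continuous_norm).continuousAt.mul
        ((hF _).continuousOn.continuousAt
          ((isOpen_halfBall ρ).mem_nhds ⟨h, hX⟩))).continuousWithinAt
    · refine ContinuousAt.continuousWithinAt ((continuousAt_const (y := (0 : ℝ))).congr ?_)
      filter_upwards [(isOpen_lt continuous_const continuous_norm).mem_nhds
        (hr₁.trans_le h : X ∈ {Y | r₁ < ‖Y‖})] with Y hY using (hk0 Y (le_of_lt hY)).symm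
  obtain ⟨C, hC⟩ := hbound' r₁ hr₁
  obtain ⟨M, hM⟩ := isCompact_Icc.exists_bound_of_continuousOn
    (hη.continuous.continuousOn (s := Icc 0 r₁))
  have hkC : ∀ X : EuclideanSpace ℝ (Fin (n + 1)), 0 < X (Fin.last n) → |k X| ≤ |M| * |C| := by
    intro X hX
    rcases le_or_gt ‖X‖ r₁ with h | h
    · rw [hk, abs_mul]
      exact mul_le_mul ((hM _ ⟨norm_nonneg _, h⟩).trans (le_abs_self M))
        ((hC X h hX).trans (le_abs_self C)) (abs_nonneg _) (abs_nonneg M)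
    · rw [hk0 X h.le, abs_zero]
      positivity
  have hklim : ∀ x, Filter.Tendsto (fun t => k (snocE x t)) (nhdsWithin 0 (Ioi 0))
      (nhds (η ‖x‖ * f₀ x)) := by
    intro x
    rcases lt_or_ge ‖x‖ ρ with h | h
    · refine Filter.Tendsto.mul ?_ (hlim x (by simpa using h))
      have hc : Continuous fun t => η ‖snocE x t‖ :=
        hη.continuous.comp (continuous_norm.comp
          (continuous_snocE.comp (Continuous.prodMk_right x)))
      simpa [norm_snocE_zero] using (hc.tendsto 0).mono_left nhdsWithin_le_nhds
    · rw [hη0 _ (hr₁.le.trans h), zero_mul]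
      exact tendsto_const_nhds.congr fun t =>
        (hk0 _ ((hr₁.le.trans h).trans (norm_le_norm_snocE x t))).symm
  have ht2 := tendsto_integral_deriv_smoothCutoff_last_mul hkc hkC hk0 hklim
  have hχc : ∀ ε, Continuous fun X : EuclideanSpace ℝ (Fin (n + 1)) =>
      smoothCutoff ε (X (Fin.last n)) := fun ε =>
    (contDiff_smoothCutoff ε).continuous.comp (by fun_prop)
  have hle : ∀ ε X, ‖smoothCutoff ε (X (Fin.last n)) * d X‖ ≤ ‖d X‖ := fun ε X => by
    rw [norm_mul, Real.norm_of_nonneg (smoothCutoff_nonneg _ _)]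
    exact mul_le_of_le_one_left (norm_nonneg _) (smoothCutoff_le_one _ _)
  have hmeas : ∀ ε, AEStronglyMeasurable
      (fun X : EuclideanSpace ℝ (Fin (n + 1)) => smoothCutoff ε (X (Fin.last n)) * d X) volume :=
    fun ε => (hχc ε).aestronglyMeasurable.mul hdint.1
  have ht1 : Filter.Tendsto (fun ε => ∫ X, smoothCutoff ε (X (Fin.last n)) * d X)
      (nhdsWithin 0 (Ioi 0)) (nhds (∫ X, d X)) := by
    refine tendsto_integral_filter_of_dominated_convergence (fun X => ‖d X‖)
      (.of_forall hmeas) (.of_forall fun ε => .of_forall (hle ε)) hdint.norm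
      (.of_forall fun X => ?_)
    by_cases hX : X ∈ halfBall n ρ
    · simpa using (tendsto_smoothCutoff hX.2).mul_const (d X)
    · simp [hd, hX]
  refine tendsto_nhds_unique (ht1.add ht2) (tendsto_const_nhds.congr' ?_)
  filter_upwards [self_mem_nhdsWithin] with ε hε
  rw [← integral_add (hdint.mono (hmeas ε) (.of_forall (hle ε)))
    (integrable_deriv_smoothCutoff_last_mul hε hkc hk0),
    ← integral_radial_mul_cutoff_eq_zero hr₁ hε hF hdiv hη hη0]
  refine integral_congr_ae (.of_forall fun X => ?_)
  by_cases hX : X ∈ halfBall n ρ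
  · simp [hd, hk, hX]
  · rcases le_or_gt (X (Fin.last n)) ε with h | h
    · simp [smoothCutoff_of_le hε h, hk]
    · have h' : ρ ≤ ‖X‖ := by
        by_contra! h'
        exact hX ⟨h', lt_trans hε h⟩
      simp [hd, hk, hX, hη'0 _ (hr₁.trans_le h')]

end FluxIdentity

section HemisphereFlux

variable {n : ℕ}

/-- The flux of `F` through the half-sphere of radius `r`. -/
def hemisphereFlux (F : EuclideanSpace ℝ (Fin (n + 1)) → EuclideanSpace ℝ (Fin (n + 1)))
    (r : ℝ) : ℝ :=
  r ^ n * ∫ ω in {ω : sphere (0 : EuclideanSpace ℝ (Fin (n + 1))) 1 |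
    0 < (ω : EuclideanSpace ℝ (Fin (n + 1))) (Fin.last n)},
      ⟪(ω : EuclideanSpace ℝ (Fin (n + 1))), F (r • (ω : EuclideanSpace ℝ (Fin (n + 1))))⟫
    ∂(volume : Measure (EuclideanSpace ℝ (Fin (n + 1)))).toSphere

lemma measurableSet_sphere_last_pos :
    MeasurableSet {ω : sphere (0 : EuclideanSpace ℝ (Fin (n + 1))) 1 |
      0 < (ω : EuclideanSpace ℝ (Fin (n + 1))) (Fin.last n)} :=
  measurableSet_last_pos.preimage measurable_subtype_coe

lemma integral_radial_flux_eq_integral_hemisphereFlux {ρ r₁ : ℝ} (hr₁ : r₁ < ρ)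
    {F : EuclideanSpace ℝ (Fin (n + 1)) → EuclideanSpace ℝ (Fin (n + 1))}
    {θ : ℝ → ℝ} (hθ0 : ∀ r, r₁ < r → θ r = 0)
    (hint : Integrable ((halfBall n ρ).indicator fun X => θ ‖X‖ * (⟪X, F X⟫ / ‖X‖))) :
    ∫ X, (halfBall n ρ).indicator (fun X => θ ‖X‖ * (⟪X, F X⟫ / ‖X‖)) X =
      ∫ r in Ioi 0, θ r * hemisphereFlux F r := by
  rw [integral_eq_integral_polar,
    integral_prod_symm _ ((integrable_iff_integrable_polar volume).1 hint)]
  refine setIntegral_congr_fun measurableSet_Ioi fun r hr => ?_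
  rw [mem_Ioi] at hr
  rcases le_or_gt r r₁ with h | h
  · rw [hemisphereFlux, ← integral_indicator measurableSet_sphere_last_pos, ← integral_const_mul,
      ← integral_const_mul]
    refine integral_congr_ae (.of_forall fun ω => ?_)
    have hω : ‖(ω : EuclideanSpace ℝ (Fin (n + 1)))‖ = 1 := by simp
    have hnorm : ‖r • (ω : EuclideanSpace ℝ (Fin (n + 1)))‖ = r := by
      rw [norm_smul, hω, mul_one, Real.norm_of_nonneg hr.le]
    by_cases hpos : 0 < (ω : EuclideanSpace ℝ (Fin (n + 1))) (Fin.last n)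
    · have hmem : r • (ω : EuclideanSpace ℝ (Fin (n + 1))) ∈ halfBall n ρ :=
        ⟨by rw [hnorm]; exact h.trans_lt hr₁, by simpa using mul_pos hr hpos⟩
      simp only [indicator_of_mem hmem, hnorm, real_inner_smul_left]
      rw [indicator_of_mem (show ω ∈ {ω : sphere (0 : EuclideanSpace ℝ (Fin (n + 1))) 1 |
        0 < (ω : EuclideanSpace ℝ (Fin (n + 1))) (Fin.last n)} from hpos)]
      simp only [finrank_euclideanSpace, Fintype.card_fin, Nat.add_sub_cancel]
      field_simp
    · have hmem : r • (ω : EuclideanSpace ℝ (Fin (n + 1))) ∉ halfBall n ρ := fun hm =>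
        hpos (pos_of_mul_pos_right (by simpa using hm.2) hr.le)
      simp [hmem, hpos]
  · simp only [hθ0 r h, zero_mul]
    refine integral_eq_zero_of_ae (.of_forall fun ω => ?_)
    have hnorm : ‖r • (ω : EuclideanSpace ℝ (Fin (n + 1)))‖ = r := by
      rw [norm_smul, Real.norm_of_nonneg hr.le]
      simp
    simp [indicator, hnorm, hθ0 r h]

lemma continuousOn_hemisphereFlux {ρ b : ℝ} (hb : -1 < b)
    {F : EuclideanSpace ℝ (Fin (n + 1)) → EuclideanSpace ℝ (Fin (n + 1))}
    (hF : ContinuousOn F (halfBall n ρ))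
    (hbound : ∀ r < ρ, ∃ C, ∀ X : EuclideanSpace ℝ (Fin (n + 1)), ‖X‖ ≤ r → 0 < X (Fin.last n) →
      ‖F X‖ ≤ C * X (Fin.last n) ^ b) :
    ContinuousOn (hemisphereFlux F) (Ioo 0 ρ) := by
  intro r₀ hr₀
  obtain ⟨r₁, hr₁, hr₁ρ⟩ := exists_between hr₀.2
  obtain ⟨C, hC⟩ := hbound r₁ hr₁ρ
  obtain ⟨M, hM⟩ := isCompact_Icc.exists_bound_of_continuousOn
    (f := fun r : ℝ => r ^ b) (s := Icc (r₀ / 2) r₁) (continuousOn_id.rpow_const fun r hr =>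
      Or.inl ((half_pos hr₀.1).trans_le hr.1).ne')
  have hmem : ∀ r ∈ Ioo 0 ρ, ∀ ω : sphere (0 : EuclideanSpace ℝ (Fin (n + 1))) 1,
      0 < (ω : EuclideanSpace ℝ (Fin (n + 1))) (Fin.last n) →
      r • (ω : EuclideanSpace ℝ (Fin (n + 1))) ∈ halfBall n ρ := fun r hr ω hω => by
    refine ⟨?_, by simpa using mul_pos hr.1 hω⟩
    rw [norm_smul, Real.norm_of_nonneg hr.1.le]
    simpa using hr.2
  refine ContinuousAt.continuousWithinAt (ContinuousAt.mul (by fun_prop) ?_)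
  refine continuousAt_of_dominated
    (bound := fun ω => |C| * |M| * (ω : EuclideanSpace ℝ (Fin (n + 1))) (Fin.last n) ^ b)
    ?_ ?_ ((integrableOn_sphere_last_rpow hb).const_mul _) ?_
  · filter_upwards [Ioo_mem_nhds hr₀.1 hr₀.2] with r hr
    refine ContinuousOn.aestronglyMeasurable ?_ measurableSet_sphere_last_pos
    exact continuous_subtype_val.continuousOn.inner
      (hF.comp (by fun_prop) fun ω hω => hmem r hr ω hω)
  · filter_upwards [Ioo_mem_nhds (half_lt_self hr₀.1) hr₁] with r hr
    filter_upwards [ae_restrict_mem measurableSet_sphere_last_pos] with ω hω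
    have hr0 : 0 < r := (half_pos hr₀.1).trans hr.1
    have hω1 : ‖(ω : EuclideanSpace ℝ (Fin (n + 1)))‖ = 1 := by simp
    have h1 := hC (r • (ω : EuclideanSpace ℝ (Fin (n + 1))))
      (by rw [norm_smul, hω1, Real.norm_of_nonneg hr0.le, mul_one]; exact hr.2.le)
      (by simpa using mul_pos hr0 hω)
    have h2 := hM r ⟨hr.1.le, hr.2.le⟩
    have hpos : 0 ≤ (ω : EuclideanSpace ℝ (Fin (n + 1))) (Fin.last n) ^ b :=
      rpow_nonneg (le_of_lt hω) _
    rw [Real.norm_of_nonneg (rpow_nonneg hr0.le _)] at h2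
    calc ‖⟪(ω : EuclideanSpace ℝ (Fin (n + 1))), F (r • (ω : EuclideanSpace ℝ (Fin (n + 1))))⟫‖
        ≤ ‖F (r • (ω : EuclideanSpace ℝ (Fin (n + 1))))‖ := by
          simpa [hω1] using norm_inner_le_norm (𝕜 := ℝ) (ω : EuclideanSpace ℝ (Fin (n + 1)))
            (F (r • (ω : EuclideanSpace ℝ (Fin (n + 1)))))
      _ ≤ C * (r * (ω : EuclideanSpace ℝ (Fin (n + 1))) (Fin.last n)) ^ b := by simpa using h1
      _ = C * (r ^ b * (ω : EuclideanSpace ℝ (Fin (n + 1))) (Fin.last n) ^ b) := by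
          rw [mul_rpow hr0.le (le_of_lt hω)]
      _ ≤ |C| * (|M| * (ω : EuclideanSpace ℝ (Fin (n + 1))) (Fin.last n) ^ b) := by
          gcongr
          · exact le_abs_self C
          · exact h2.trans (le_abs_self M)
      _ = _ := by ring
  · filter_upwards [ae_restrict_mem measurableSet_sphere_last_pos] with ω hω
    exact continuousAt_const.inner (ContinuousAt.comp
      (f := fun r : ℝ => r • (ω : EuclideanSpace ℝ (Fin (n + 1))))
      (hF.continuousAt ((isOpen_halfBall ρ).mem_nhds (hmem r₀ hr₀ ω hω))) (by fun_prop))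

/-- The divergence theorem on the half-ball of radius `R` for a divergence-free field which may be
singular at the flat boundary `{t = 0}`, but whose last component has the trace `f₀` there. -/
theorem hemisphereFlux_eq_setIntegral_ball {ρ R b : ℝ} (hR : R ∈ Ioo 0 ρ) (hb : -1 < b)
    {F : EuclideanSpace ℝ (Fin (n + 1)) → EuclideanSpace ℝ (Fin (n + 1))}
    {f₀ : EuclideanSpace ℝ (Fin n) → ℝ}
    (hF : ∀ i, ContDiffOn ℝ 1 (fun X => F X i) (halfBall n ρ))
    (hdiv : ∀ X ∈ halfBall n ρ,
      ∑ i, fderiv ℝ (fun Y => F Y i) X (EuclideanSpace.single i 1) = 0)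
    (hbound : ∀ r < ρ, ∃ C, ∀ X : EuclideanSpace ℝ (Fin (n + 1)), ‖X‖ ≤ r → 0 < X (Fin.last n) →
      ‖F X‖ ≤ C * X (Fin.last n) ^ b)
    (hbound' : ∀ r < ρ, ∃ C, ∀ X : EuclideanSpace ℝ (Fin (n + 1)), ‖X‖ ≤ r → 0 < X (Fin.last n) →
      |F X (Fin.last n)| ≤ C)
    (hf₀ : ContinuousOn f₀ (ball 0 ρ))
    (hlim : ∀ x ∈ ball (0 : EuclideanSpace ℝ (Fin n)) ρ, Filter.Tendsto
      (fun t => F (snocE x t) (Fin.last n)) (nhdsWithin 0 (Ioi 0)) (nhds (f₀ x))) :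
    hemisphereFlux F R = ∫ x in ball 0 R, f₀ x := by
  have hFc : ContinuousOn F (halfBall n ρ) :=
    continuousOn_of_forall_apply fun i => (hF i).continuousOn
  obtain ⟨r₁, hRr₁, hr₁⟩ := exists_between hR.2
  have hAc := continuousOn_hemisphereFlux hb hFc hbound
  set η : ℝ → ℝ → ℝ := fun ε r => 1 - smoothCutoff ε (r - R) with hηdef
  have hη : ∀ ε, ContDiff ℝ 1 (η ε) := fun ε =>
    contDiff_const.sub ((contDiff_smoothCutoff ε).comp (contDiff_id.sub contDiff_const))
  have hη' : ∀ ε r, deriv (η ε) r = -deriv (smoothCutoff ε) (r - R) := fun ε r => by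
    rw [hηdef, deriv_const_sub, deriv_comp_sub_const]
  have hsmall : ∀ᶠ ε in nhdsWithin (0 : ℝ) (Ioi 0), 0 < ε ∧ 2 * ε < r₁ - R := by
    filter_upwards [Ioo_mem_nhdsGT (half_pos (sub_pos.2 hRr₁))] with ε hε
    exact ⟨hε.1, by linarith [hε.2]⟩
  set G : ℝ → ℝ := (Ioo 0 (r₁ - R)).indicator fun t => hemisphereFlux F (t + R) with hG
  have hcR : ContinuousAt (fun t => hemisphereFlux F (t + R)) 0 := by
    refine ContinuousAt.comp (g := hemisphereFlux F) ?_ (by fun_prop)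
    rw [zero_add]
    exact hAc.continuousAt (Ioo_mem_nhds hR.1 hR.2)
  have hGlim : Filter.Tendsto G (nhdsWithin 0 (Ioi 0)) (nhds (hemisphereFlux F R)) := by
    have h := hcR.tendsto.mono_left (nhdsWithin_le_nhds (s := Ioi 0))
    rw [zero_add] at h
    refine h.congr' ?_
    filter_upwards [Ioo_mem_nhdsGT (sub_pos.2 hRr₁)] with t ht
    rw [hG, indicator_of_mem ht]
  have hGint : ∀ ε, 0 < ε → Integrable fun t => deriv (smoothCutoff ε) t * G t := by
    intro ε _
    have h : ContinuousOn (fun t => deriv (smoothCutoff ε) t * hemisphereFlux F (t + R))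
        (Icc 0 (r₁ - R)) :=
      (continuous_deriv_smoothCutoff ε).continuousOn.mul (hAc.comp (by fun_prop) fun t ht =>
        ⟨by linarith [ht.1, hR.1], by linarith [ht.2]⟩)
    have h2 := (integrable_indicator_iff measurableSet_Ioo).2
      ((h.integrableOn_Icc (μ := volume)).mono_set Ioo_subset_Icc_self)
    refine h2.congr (.of_forall fun t => ?_)
    simp only [hG, indicator_apply]
    split_ifs <;> simp
  have ht1 := tendsto_integral_deriv_smoothCutoff_mul hGlim hGint
  have ht2 : Filter.Tendsto (fun ε => ∫ x, η ε ‖x‖ * f₀ x) (nhdsWithin 0 (Ioi 0))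
      (nhds (∫ x in closedBall 0 R, f₀ x)) := by
    rw [← integral_indicator measurableSet_closedBall]
    have hf₁ : IntegrableOn f₀ (closedBall 0 r₁) :=
      (hf₀.mono (closedBall_subset_ball hr₁)).integrableOn_compact (isCompact_closedBall 0 r₁)
    have hind : ∀ᶠ ε in nhdsWithin (0 : ℝ) (Ioi 0), (fun x => η ε ‖x‖ * f₀ x) =
        fun x => η ε ‖x‖ * (closedBall 0 r₁).indicator f₀ x := by
      filter_upwards [hsmall] with ε hε
      ext x
      rcases le_or_gt ‖x‖ r₁ with h | h
      · rw [indicator_of_mem (by simpa using h)]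
      · have : η ε ‖x‖ = 0 := by
          simp [hηdef, smoothCutoff_of_two_mul_le hε.1 (show 2 * ε ≤ ‖x‖ - R by linarith [hε.2])]
        rw [this, zero_mul, zero_mul]
    refine tendsto_integral_filter_of_dominated_convergence
      (fun x => ‖(closedBall 0 r₁).indicator f₀ x‖) ?_ ?_
      ((integrable_indicator_iff measurableSet_closedBall).2 hf₁).norm (.of_forall fun x => ?_)
    · filter_upwards [hind] with ε h
      rw [h]
      exact ((hη ε).continuous.comp continuous_norm).aestronglyMeasurable.mul
        ((integrable_indicator_iff measurableSet_closedBall).2 hf₁).1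
    · filter_upwards [hind] with ε h
      refine .of_forall fun x => ?_
      rw [congrFun h x, norm_mul]
      refine mul_le_of_le_one_left (norm_nonneg _) ?_
      rw [Real.norm_eq_abs, abs_le]
      constructor <;>
        linarith [smoothCutoff_nonneg ε (‖x‖ - R), smoothCutoff_le_one ε (‖x‖ - R)]
    · rcases le_or_gt ‖x‖ R with h | h
      · rw [indicator_of_mem (by simpa using h)]
        refine tendsto_const_nhds.congr' ?_
        filter_upwards [hsmall] with ε hε
        simp [hηdef, smoothCutoff_of_le hε.1 (show ‖x‖ - R ≤ ε by linarith [hε.1])]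
      · rw [indicator_of_notMem (by simpa using h)]
        have := ((tendsto_smoothCutoff (sub_pos.2 h)).const_sub 1).mul_const (f₀ x)
        simpa using this
  have hmain : ∀ᶠ ε in nhdsWithin (0 : ℝ) (Ioi 0),
      ∫ x, η ε ‖x‖ * f₀ x = ∫ t, deriv (smoothCutoff ε) t * G t := by
    filter_upwards [hsmall] with ε hε
    have hη0 : ∀ r, r₁ ≤ r → η ε r = 0 := fun r hr => by
      rw [hηdef]
      simp only
      rw [smoothCutoff_of_two_mul_le hε.1 (by linarith [hε.2]), sub_self]
    have hη'0 : ∀ r, r₁ < r → deriv (η ε) r = 0 := fun r hr => by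
      rw [hη', deriv_smoothCutoff_of_two_mul_le hε.1 (by linarith [hε.2]), neg_zero]
    have h1 := integral_radial_flux_add_integral_eq_zero hr₁ hb hF hdiv hbound hbound' hlim
      (hη ε) hη0
    rw [integral_radial_flux_eq_integral_hemisphereFlux hr₁ hη'0
      (integrable_radial_flux hr₁ hb hFc hbound (hη ε).continuous_deriv_one hη'0),
      ← integral_indicator measurableSet_Ioi, ← integral_add_right_eq_self _ R] at h1
    rw [eq_neg_of_add_eq_zero_right h1, ← integral_neg]
    refine integral_congr_ae (.of_forall fun t => ?_)
    simp only [indicator_apply, hη', hG, add_sub_cancel_right, mem_Ioi]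
    rcases le_or_gt t 0 with h | h
    · simp [deriv_smoothCutoff_of_le hε.1 (h.trans hε.1.le)]
    rcases lt_or_ge t (r₁ - R) with h' | h'
    · rw [if_pos (by linarith [hR.1]), if_pos ⟨h, h'⟩]
      ring
    · simp [deriv_smoothCutoff_of_two_mul_le hε.1 (hε.2.le.trans h')]
  have key := tendsto_nhds_unique (ht1.congr' (hmain.mono fun ε h => h.symm)) ht2
  rw [key]
  rw [← ball_union_sphere]
  exact setIntegral_congr_set (union_ae_eq_left_of_ae_eq_empty
    (ae_eq_empty.2 (Measure.addHaar_sphere_of_ne_zero volume 0 hR.1.ne')))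

end HemisphereFlux

section PohozaevField

variable {n : ℕ}

/-- The vector field whose divergence gives the Pohozaev identity for `div (t ^ a ∇U) = 0`. -/
def pohozaevField (a c : ℝ) (U : EuclideanSpace ℝ (Fin (n + 1)) → ℝ)
    (X : EuclideanSpace ℝ (Fin (n + 1))) : EuclideanSpace ℝ (Fin (n + 1)) :=
  X (Fin.last n) ^ a •
    ((c * U X + ⟪gradient U X, X⟫) • gradient U X - (‖gradient U X‖ ^ 2 / 2) • X)

lemma gradient_apply {m : ℕ} (U : EuclideanSpace ℝ (Fin m) → ℝ) (X : EuclideanSpace ℝ (Fin m))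
    (i : Fin m) : gradient U X i = fderiv ℝ U X (EuclideanSpace.single i 1) := by
  rw [← inner_gradient_left, EuclideanSpace.inner_single_right]
  simp

lemma inner_gradient_eq_sum {m : ℕ} (U : EuclideanSpace ℝ (Fin m) → ℝ)
    (X Y : EuclideanSpace ℝ (Fin m)) :
    ⟪gradient U X, Y⟫ = ∑ j, Y j * fderiv ℝ U X (EuclideanSpace.single j 1) := by
  rw [PiLp.inner_apply]
  simp [gradient_apply]

lemma norm_gradient_sq {m : ℕ} (U : EuclideanSpace ℝ (Fin m) → ℝ) (X : EuclideanSpace ℝ (Fin m)) :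
    ‖gradient U X‖ ^ 2 = ∑ j, fderiv ℝ U X (EuclideanSpace.single j 1) ^ 2 := by
  simp [EuclideanSpace.real_norm_sq_eq, gradient_apply]

lemma pohozaevField_apply (a c : ℝ) (U : EuclideanSpace ℝ (Fin (n + 1)) → ℝ)
    (X : EuclideanSpace ℝ (Fin (n + 1))) (i : Fin (n + 1)) :
    pohozaevField a c U X i = X (Fin.last n) ^ a *
      ((c * U X + ∑ j, X j * fderiv ℝ U X (EuclideanSpace.single j 1)) *
          fderiv ℝ U X (EuclideanSpace.single i 1) -
        (∑ j, fderiv ℝ U X (EuclideanSpace.single j 1) ^ 2) / 2 * X i) := by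
  simp [pohozaevField, gradient_apply, inner_gradient_eq_sum, norm_gradient_sq,
    -inner_gradient_left]

lemma contDiffOn_pohozaevField {a c ρ : ℝ} {U : EuclideanSpace ℝ (Fin (n + 1)) → ℝ}
    (hU : ContDiffOn ℝ 2 U (halfBall n ρ)) (i : Fin (n + 1)) :
    ContDiffOn ℝ 1 (fun X => pohozaevField a c U X i) (halfBall n ρ) := by
  have hp : ∀ j, ContDiffOn ℝ 1 (fun X => fderiv ℝ U X (EuclideanSpace.single j 1))
      (halfBall n ρ) := fun j =>
    (hU.fderiv_of_isOpen (isOpen_halfBall ρ) (by norm_num)).clm_apply contDiffOn_const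
  have hx : ∀ j, ContDiffOn ℝ 1 (fun X : EuclideanSpace ℝ (Fin (n + 1)) => X j)
      (halfBall n ρ) := fun j => by fun_prop
  have hU1 : ContDiffOn ℝ 1 U (halfBall n ρ) := hU.of_le (by norm_num)
  simp only [pohozaevField_apply]
  refine ((hx _).rpow_const_of_ne fun X hX => hX.2.ne').mul
    ((((contDiffOn_const.mul hU1).add (ContDiffOn.sum fun j _ => (hx j).mul (hp j))).mul
      (hp i)).sub (((ContDiffOn.sum fun j _ => (hp j).pow 2).div_const 2).mul (hx i)))

lemma divergence_pohozaevField_eq_zero {σ : ℝ} {U : EuclideanSpace ℝ (Fin (n + 1)) → ℝ}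
    {X : EuclideanSpace ℝ (Fin (n + 1))} (hX : 0 < X (Fin.last n)) (hU : ContDiffAt ℝ 2 U X)
    (hPDE : X (Fin.last n) * lapl U X +
      (1 - 2 * σ) * fderiv ℝ U X (EuclideanSpace.single (Fin.last n) 1) = 0) :
    ∑ i, fderiv ℝ (fun Y => pohozaevField (1 - 2 * σ) (((n : ℝ) - 2 * σ) / 2) U Y i) X
      (EuclideanSpace.single i 1) = 0 := by
  set a := 1 - 2 * σ with ha
  set c := ((n : ℝ) - 2 * σ) / 2 with hc
  set e : Fin (n + 1) → EuclideanSpace ℝ (Fin (n + 1)) := fun i => EuclideanSpace.single i 1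
    with he
  set p : Fin (n + 1) → EuclideanSpace ℝ (Fin (n + 1)) → ℝ := fun i Y => fderiv ℝ U Y (e i)
    with hpdef
  set t := X (Fin.last n) with ht
  have hU1 : HasFDerivAt U (fderiv ℝ U X) X := (hU.differentiableAt (by norm_num)).hasFDerivAt
  have hU2 : DifferentiableAt ℝ (fderiv ℝ U) X :=
    (hU.fderiv_right (m := 1) (by norm_num)).differentiableAt (by norm_num)
  have hp : ∀ j, HasFDerivAt (p j) (fderiv ℝ (p j) X) X := fun j =>
    (hU2.clm_apply (differentiableAt_const _)).hasFDerivAt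
  have hsymm : ∀ i j, fderiv ℝ (p j) X (e i) = fderiv ℝ (p i) X (e j) := by
    intro i j
    have h : ∀ k v, fderiv ℝ (p k) X v = fderiv ℝ (fderiv ℝ U) X v (e k) := fun k v => by
      rw [hpdef]
      simp only
      rw [fderiv_clm_apply hU2 (differentiableAt_const _)]
      simp
    rw [h, h]
    exact hU.isSymmSndFDerivAt (by simp) _ _
  have hx : ∀ j, HasFDerivAt (fun Y : EuclideanSpace ℝ (Fin (n + 1)) => Y j)
      (EuclideanSpace.proj (𝕜 := ℝ) j : EuclideanSpace ℝ (Fin (n + 1)) →L[ℝ] ℝ) X := fun j =>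
    (EuclideanSpace.proj (𝕜 := ℝ) j : EuclideanSpace ℝ (Fin (n + 1)) →L[ℝ] ℝ).hasFDerivAt
  have hterm : ∀ i, fderiv ℝ (fun Y => pohozaevField a c U Y i) X (e i) =
      t ^ a * ((c * p i X + (p i X + ∑ j, X j * fderiv ℝ (p j) X (e i))) * p i X +
        (c * U X + ∑ j, X j * p j X) * fderiv ℝ (p i) X (e i) -
        ((∑ j, p j X * fderiv ℝ (p j) X (e i)) * X i + (∑ j, p j X ^ 2) / 2)) +
      (if i = Fin.last n then a * t ^ (a - 1) * ((c * U X + ∑ j, X j * p j X) * p i X -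
        (∑ j, p j X ^ 2) / 2 * X i) else 0) := by
    intro i
    have h := ((hx (Fin.last n)).rpow_const (p := a) (Or.inl hX.ne')).mul
      ((((hU1.const_mul c).add (HasFDerivAt.fun_sum fun j (_ : j ∈ Finset.univ) =>
        (hx j).mul (hp j))).mul (hp i)).sub
        (((HasFDerivAt.fun_sum fun j (_ : j ∈ Finset.univ) => (hp j).pow 2).mul_const
          (2⁻¹)).mul (hx i)))
    have hfun : (fun Y => pohozaevField a c U Y i) = _ := funext fun Y =>
      pohozaevField_apply a c U Y i
    rw [hfun]
    simp only [div_eq_mul_inv] at h ⊢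
    refine (DFunLike.congr_fun h.fderiv (e i)).trans ?_
    have hei : ∀ j, e i j = if j = i then 1 else 0 := fun j => by simp [he]
    have hpe : ∀ j, fderiv ℝ U X (e j) = p j X := fun j => rfl
    have hs2 : ∑ j, 2 * p j X * fderiv ℝ (p j) X (e i) =
        2 * ∑ j, p j X * fderiv ℝ (p j) X (e i) := by
      simp only [Finset.mul_sum, mul_assoc]
    simp [hei, eq_comm (a := Fin.last n) (b := i), hs2, hpe, Finset.sum_add_distrib, ← ht]
    split_ifs <;> ring
  have hsum : ∑ i, (∑ j, X j * fderiv ℝ (p j) X (e i)) * p i X =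
      ∑ i, (∑ j, p j X * fderiv ℝ (p j) X (e i)) * X i := by
    simp only [Finset.sum_mul]
    rw [Finset.sum_comm]
    refine Finset.sum_congr rfl fun i _ => Finset.sum_congr rfl fun j _ => ?_
    rw [hsymm j i]
    ring
  have hPDE' : t * (∑ i, fderiv ℝ (p i) X (e i)) + a * p (Fin.last n) X = 0 := hPDE
  have hpow : t ^ a = t ^ (a - 1) * t := by
    rw [← rpow_add_one hX.ne', sub_add_cancel]
  calc _ = t ^ a * ((c + 1) * (∑ i, p i X ^ 2) +
        ((∑ i, (∑ j, X j * fderiv ℝ (p j) X (e i)) * p i X) -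
          ∑ i, (∑ j, p j X * fderiv ℝ (p j) X (e i)) * X i) +
        (c * U X + ∑ j, X j * p j X) * (∑ i, fderiv ℝ (p i) X (e i)) -
        (n + 1) * ((∑ j, p j X ^ 2) / 2)) +
      a * t ^ (a - 1) * ((c * U X + ∑ j, X j * p j X) * p (Fin.last n) X -
        (∑ j, p j X ^ 2) / 2 * t) := by
        rw [Finset.sum_congr rfl fun i _ => hterm i, Finset.sum_add_distrib,
          Finset.sum_ite_eq' Finset.univ, if_pos (Finset.mem_univ _), ← Finset.mul_sum]
        congr 2
        · generalize c * U X + ∑ j, X j * p j X = S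
          have h : ∀ i, (c * p i X + (p i X + ∑ j, X j * fderiv ℝ (p j) X (e i))) * p i X +
              S * fderiv ℝ (p i) X (e i) -
              ((∑ j, p j X * fderiv ℝ (p j) X (e i)) * X i + (∑ j, p j X ^ 2) / 2) = (c + 1) * p i X ^ 2 +
              ((∑ j, X j * fderiv ℝ (p j) X (e i)) * p i X -
                (∑ j, p j X * fderiv ℝ (p j) X (e i)) * X i) +
              S * fderiv ℝ (p i) X (e i) - (∑ j, p j X ^ 2) / 2 := fun i => by ring
          rw [Finset.sum_congr rfl fun i _ => h i]
          simp only [Finset.sum_add_distrib, Finset.sum_sub_distrib, ← Finset.mul_sum]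
          simp
    _ = t ^ (a - 1) * (c * U X + ∑ j, X j * p j X) *
          (t * (∑ i, fderiv ℝ (p i) X (e i)) + a * p (Fin.last n) X) := by
        rw [hsum, hpow, ha, hc]
        ring
    _ = 0 := by rw [hPDE', mul_zero]

end PohozaevField

section PohozaevBounds

variable {n : ℕ}

lemma isBigO_last_rpow {b s : ℝ} (h : b ≤ s) (r : ℝ) :
    (fun X : EuclideanSpace ℝ (Fin (n + 1)) => X (Fin.last n) ^ s) =O[Filter.principal
      {X | ‖X‖ ≤ r ∧ 0 < X (Fin.last n)}] fun X => X (Fin.last n) ^ b := by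
  refine Asymptotics.isBigO_principal.2 ⟨r ^ (s - b), fun X hX => ?_⟩
  have hle : X (Fin.last n) ≤ r := (le_abs_self _).trans ((abs_last_le_norm X).trans hX.1)
  rw [Real.norm_of_nonneg (rpow_nonneg hX.2.le _), Real.norm_of_nonneg (rpow_nonneg hX.2.le _)]
  calc X (Fin.last n) ^ s = X (Fin.last n) ^ (s - b) * X (Fin.last n) ^ b := by
        rw [← rpow_add hX.2, sub_add_cancel]
    _ ≤ r ^ (s - b) * X (Fin.last n) ^ b := by
        gcongr
        · exact rpow_nonneg hX.2.le _
        · exact hX.2.le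

lemma exists_forall_abs_le_of_tendstoLocallyUniformlyOn {ρ r : ℝ} (hr : r < ρ)
    {w : EuclideanSpace ℝ (Fin (n + 1)) → ℝ} (hw : ContinuousOn w (halfBall n ρ))
    {k₀ : EuclideanSpace ℝ (Fin n) → ℝ} (hk₀ : ContinuousOn k₀ (ball 0 ρ))
    (hlim : TendstoLocallyUniformlyOn (fun t x => w (snocE x t)) k₀ (nhdsWithin 0 (Ioi 0))
      (ball 0 ρ)) :
    ∃ C, ∀ X : EuclideanSpace ℝ (Fin (n + 1)), ‖X‖ ≤ r → 0 < X (Fin.last n) → |w X| ≤ C := by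
  have hsub : closedBall (0 : EuclideanSpace ℝ (Fin n)) r ⊆ ball 0 ρ := closedBall_subset_ball hr
  have hunif := (tendstoLocallyUniformlyOn_iff_forall_isCompact isOpen_ball).1 hlim _ hsub
    (isCompact_closedBall 0 r)
  obtain ⟨C₁, hC₁⟩ := (isCompact_closedBall 0 r).exists_bound_of_continuousOn (hk₀.mono hsub)
  obtain ⟨δ, hδ, hδw⟩ := mem_nhdsGT_iff_exists_Ioo_subset.1
    (Metric.tendstoUniformlyOn_iff.1 hunif 1 one_pos)
  have hcomp : IsCompact {X : EuclideanSpace ℝ (Fin (n + 1)) | ‖X‖ ≤ r ∧ δ ≤ X (Fin.last n)} := by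
    refine (isCompact_closedBall (0 : EuclideanSpace ℝ (Fin (n + 1))) r).of_isClosed_subset
      ((isClosed_le continuous_norm continuous_const).inter
        (isClosed_le continuous_const (EuclideanSpace.proj (𝕜 := ℝ) (Fin.last n)).continuous)) fun X hX => ?_
    simpa using hX.1
  obtain ⟨C₂, hC₂⟩ := hcomp.exists_bound_of_continuousOn
    (hw.mono fun X hX => ⟨hX.1.trans_lt hr, lt_of_lt_of_le hδ hX.2⟩)
  refine ⟨max (C₁ + 1) C₂, fun X hXr hX0 => ?_⟩
  rcases lt_or_ge (X (Fin.last n)) δ with h | h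
  · obtain ⟨x, t, rfl⟩ := exists_snocE_eq X
    rw [snocE_last] at h hX0
    have hx : x ∈ closedBall (0 : EuclideanSpace ℝ (Fin n)) r := by
      simpa using (norm_le_norm_snocE x t).trans hXr
    have h1 := hδw ⟨hX0, h⟩ x hx
    have h2 := hC₁ x hx
    rw [Real.dist_eq, abs_lt] at h1
    rw [Real.norm_eq_abs, abs_le] at h2
    refine le_max_of_le_left (abs_le.2 ⟨?_, ?_⟩) <;> linarith [h1.1, h1.2, h2.1, h2.2]
  · exact le_max_of_le_right (hC₂ X ⟨hXr, h⟩)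

variable {a c : ℝ} {U : EuclideanSpace ℝ (Fin (n + 1)) → ℝ} {X : EuclideanSpace ℝ (Fin (n + 1))}

lemma pohozaevField_apply_last (hX : 0 < X (Fin.last n)) {g : EuclideanSpace ℝ (Fin n)}
    (hg : ∀ i : Fin n, g i = fderiv ℝ U X (EuclideanSpace.single i.castSucc 1)) {w : ℝ}
    (hw : w = X (Fin.last n) ^ a * fderiv ℝ U X (EuclideanSpace.single (Fin.last n) 1)) :
    pohozaevField a c U X (Fin.last n) =
      (c * U X + ∑ j, X (Fin.castSucc j) * g j) * w + X (Fin.last n) ^ (1 - a) * w ^ 2 / 2 -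
        X (Fin.last n) ^ (1 + a) * (∑ j, g j ^ 2) / 2 := by
  rw [pohozaevField_apply, Fin.sum_univ_castSucc, Fin.sum_univ_castSucc]
  simp only [← hg]
  rw [hw, rpow_sub hX, rpow_add hX, rpow_one]
  have := (rpow_pos_of_pos hX a).ne'
  field_simp
  ring

lemma pohozaevField_apply_castSucc (hX : 0 < X (Fin.last n)) {g : EuclideanSpace ℝ (Fin n)}
    (hg : ∀ i : Fin n, g i = fderiv ℝ U X (EuclideanSpace.single i.castSucc 1)) {w : ℝ}
    (hw : w = X (Fin.last n) ^ a * fderiv ℝ U X (EuclideanSpace.single (Fin.last n) 1))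
    (i : Fin n) :
    pohozaevField a c U X i.castSucc =
      X (Fin.last n) ^ a * ((c * U X + ∑ j, X (Fin.castSucc j) * g j) * g i -
        (∑ j, g j ^ 2) / 2 * X i.castSucc) + X (Fin.last n) ^ (1 : ℝ) * (w * g i) -
        X (Fin.last n) ^ (-a) * (w ^ 2 / 2 * X i.castSucc) := by
  rw [pohozaevField_apply, Fin.sum_univ_castSucc, Fin.sum_univ_castSucc]
  simp only [← hg]
  rw [hw, rpow_neg hX.le, rpow_one]
  have := (rpow_pos_of_pos hX a).ne'
  field_simp
  ring

theorem hemisphereFlux_pohozaevField {σ ρ R : ℝ} (hσ : σ ∈ Ioo (0 : ℝ) 1) (hR : R ∈ Ioo 0 ρ)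
    (hU : ContinuousOn U {X | ‖X‖ ≤ ρ ∧ 0 ≤ X (Fin.last n)})
    (hU2 : ContDiffOn ℝ 2 U (halfBall n ρ))
    (hPDE : ∀ X ∈ halfBall n ρ, X (Fin.last n) * lapl U X +
      (1 - 2 * σ) * fderiv ℝ U X (EuclideanSpace.single (Fin.last n) 1) = 0)
    {g : EuclideanSpace ℝ (Fin (n + 1)) → EuclideanSpace ℝ (Fin n)}
    (hg : ContinuousOn g {X | ‖X‖ ≤ ρ ∧ 0 ≤ X (Fin.last n)})
    (hgU : ∀ X ∈ halfBall n ρ, ∀ i : Fin n,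
      g X i = fderiv ℝ U X (EuclideanSpace.single i.castSucc 1))
    {k₀ : EuclideanSpace ℝ (Fin n) → ℝ} (hk₀ : ContinuousOn k₀ (ball 0 ρ))
    (hlim : TendstoLocallyUniformlyOn
      (fun (t : ℝ) (x : EuclideanSpace ℝ (Fin n)) =>
        t ^ (1 - 2 * σ) * fderiv ℝ U (snocE x t) (EuclideanSpace.single (Fin.last n) 1))
      k₀ (nhdsWithin 0 (Ioi 0)) (ball 0 ρ)) :
    hemisphereFlux (pohozaevField (1 - 2 * σ) (((n : ℝ) - 2 * σ) / 2) U) R =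
      ∫ x in ball 0 R,
        (((n : ℝ) - 2 * σ) / 2 * U (snocE x 0) + ⟪x, g (snocE x 0)⟫) * k₀ x := by
  set a := 1 - 2 * σ with ha
  set c := ((n : ℝ) - 2 * σ) / 2 with hc
  set b := -|a| with hb
  have hba : b ≤ a := neg_abs_le a
  have hba' : b ≤ -a := neg_le_neg (le_abs_self a)
  have hb0 : b ≤ 0 := neg_nonpos.2 (abs_nonneg a)
  have hb1 : -1 < b := neg_lt_neg (abs_lt.2 ⟨by linarith [hσ.2], by linarith [hσ.1]⟩)
  set w : EuclideanSpace ℝ (Fin (n + 1)) → ℝ := fun X =>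
    X (Fin.last n) ^ a * fderiv ℝ U X (EuclideanSpace.single (Fin.last n) 1) with hwdef
  have hw : ContinuousOn w (halfBall n ρ) :=
    (ContinuousOn.rpow_const (by fun_prop) fun X hX => Or.inl hX.2.ne').mul
      ((hU2.continuousOn_fderiv_of_isOpen (isOpen_halfBall ρ) (by norm_num)).clm_apply
        continuousOn_const)
  have hwlim : TendstoLocallyUniformlyOn (fun t x => w (snocE x t)) k₀ (nhdsWithin 0 (Ioi 0))
      (ball 0 ρ) := by simpa [hwdef] using hlim
  have hcl : IsCompact {X : EuclideanSpace ℝ (Fin (n + 1)) | ‖X‖ ≤ ρ ∧ 0 ≤ X (Fin.last n)} := by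
    refine (isCompact_closedBall (0 : EuclideanSpace ℝ (Fin (n + 1))) ρ).of_isClosed_subset
      ((isClosed_le continuous_norm continuous_const).inter
        (isClosed_le continuous_const (EuclideanSpace.proj (𝕜 := ℝ) (Fin.last n)).continuous)) fun X hX => ?_
    simpa using hX.1
  have hbdd : ∀ {f : EuclideanSpace ℝ (Fin (n + 1)) → ℝ} {r : ℝ}, r < ρ →
      ContinuousOn f {X | ‖X‖ ≤ ρ ∧ 0 ≤ X (Fin.last n)} →
      f =O[Filter.principal {X | ‖X‖ ≤ r ∧ 0 < X (Fin.last n)}] fun _ => (1 : ℝ) := by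
    intro f r hr hf
    obtain ⟨C, hC⟩ := hcl.exists_bound_of_continuousOn hf
    exact Asymptotics.isBigO_principal.2 ⟨C, fun X hX => by
      simpa using hC X ⟨hX.1.trans hr.le, hX.2.le⟩⟩
  have hgi : ∀ i, ContinuousOn (fun X => g X i) {X | ‖X‖ ≤ ρ ∧ 0 ≤ X (Fin.last n)} := fun i =>
    (EuclideanSpace.proj (𝕜 := ℝ) i).continuous.comp_continuousOn hg
  have hwO : ∀ {r : ℝ}, r < ρ →
      w =O[Filter.principal {X | ‖X‖ ≤ r ∧ 0 < X (Fin.last n)}] fun _ => (1 : ℝ) := by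
    intro r hr
    obtain ⟨C, hC⟩ := exists_forall_abs_le_of_tendstoLocallyUniformlyOn hr hw hk₀ hwlim
    exact Asymptotics.isBigO_principal.2 ⟨C, fun X hX => by simpa using hC X hX.1 hX.2⟩
  set A : EuclideanSpace ℝ (Fin (n + 1)) → ℝ :=
    fun X => c * U X + ∑ j, X (Fin.castSucc j) * g X j with hA
  set B : EuclideanSpace ℝ (Fin (n + 1)) → ℝ := fun X => ∑ j, g X j ^ 2 with hB
  have hAc : ContinuousOn A {X | ‖X‖ ≤ ρ ∧ 0 ≤ X (Fin.last n)} :=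
    (hU.const_mul c).add (continuousOn_finsetSum _ fun j _ =>
      ContinuousOn.mul (by fun_prop) (hgi j))
  have hBc : ContinuousOn B {X | ‖X‖ ≤ ρ ∧ 0 ≤ X (Fin.last n)} :=
    continuousOn_finsetSum _ fun j _ => (hgi j).pow 2
  have hlast : ∀ X ∈ halfBall n ρ, pohozaevField a c U X (Fin.last n) =
      A X * w X + X (Fin.last n) ^ (1 - a) * w X ^ 2 / 2 - X (Fin.last n) ^ (1 + a) * B X / 2 :=
    fun X hX => pohozaevField_apply_last hX.2 (hgU X hX) rfl
  have hlastO : ∀ r < ρ, (fun X => pohozaevField a c U X (Fin.last n)) =O[Filter.principal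
      {X | ‖X‖ ≤ r ∧ 0 < X (Fin.last n)}] fun _ => (1 : ℝ) := by
    intro r hr
    have h1 := ((hbdd hr hAc).mul (hwO hr)).add
      (((isBigO_last_rpow (n := n) (b := 0) (s := 1 - a) (by linarith [hσ.1]) r).mul
        (((hwO hr).pow 2).const_mul_left (1 / 2))).congr_right (by simp))
    have h2 := h1.sub (((isBigO_last_rpow (n := n) (b := 0) (s := 1 + a)
      (by linarith [hσ.2]) r).mul ((hbdd hr hBc).const_mul_left (1 / 2))).congr_right (by simp))
    refine h2.congr' (Filter.eventually_principal.2 fun X hX => ?_) (by simp)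
    simp only [hlast X ⟨hX.1.trans_lt hr, hX.2⟩]
    ring
  have hcastO : ∀ r < ρ, ∀ i : Fin n, (fun X => pohozaevField a c U X i.castSucc) =O[
      Filter.principal {X | ‖X‖ ≤ r ∧ 0 < X (Fin.last n)}] fun X => X (Fin.last n) ^ b := by
    intro r hr i
    have hXi : ContinuousOn (fun X : EuclideanSpace ℝ (Fin (n + 1)) => X i.castSucc)
      {X | ‖X‖ ≤ ρ ∧ 0 ≤ X (Fin.last n)} := by fun_prop
    have h1 := (isBigO_last_rpow hba r).mul
      (hbdd hr ((hAc.mul (hgi i)).sub ((hBc.div_const 2).mul hXi)))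
    have h2 := (isBigO_last_rpow (hb0.trans zero_le_one) r).mul ((hwO hr).mul (hbdd hr (hgi i)))
    have h3 := (isBigO_last_rpow hba' r).mul
      ((((hwO hr).pow 2).const_mul_left (1 / 2)).mul (hbdd hr hXi))
    refine (((h1.congr_right (by simp)).add (h2.congr_right (by simp))).sub
      (h3.congr_right (by simp))).congr' (Filter.eventually_principal.2 fun X hX => ?_) .rfl
    refine Eq.trans ?_
      (pohozaevField_apply_castSucc hX.2 (hgU X ⟨hX.1.trans_lt hr, hX.2⟩) rfl i).symm
    simp only [hA, hB, hwdef, Pi.sub_apply, Pi.mul_apply]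
    ring
  have hsnoc : ∀ x ∈ ball (0 : EuclideanSpace ℝ (Fin n)) ρ,
      snocE x 0 ∈ {X : EuclideanSpace ℝ (Fin (n + 1)) | ‖X‖ ≤ ρ ∧ 0 ≤ X (Fin.last n)} :=
    fun x hx => ⟨by rw [norm_snocE_zero]; exact (mem_ball_zero_iff.1 hx).le, by simp⟩
  have hsnocc : Continuous fun x : EuclideanSpace ℝ (Fin n) => snocE x 0 :=
    continuous_snocE.comp (Continuous.prodMk_left 0)
  refine hemisphereFlux_eq_setIntegral_ball hR hb1 (contDiffOn_pohozaevField hU2) ?_ ?_ ?_ ?_ ?_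
  · exact fun X hX => divergence_pohozaevField_eq_zero hX.2
      (hU2.contDiffAt ((isOpen_halfBall ρ).mem_nhds hX)) (hPDE X hX)
  · intro r hr
    have h : ∀ i, (fun X => pohozaevField a c U X i) =O[Filter.principal
        {X | ‖X‖ ≤ r ∧ 0 < X (Fin.last n)}] fun X => X (Fin.last n) ^ b := fun i => by
      refine Fin.lastCases ?_ (hcastO r hr) i
      exact (hlastO r hr).trans ((isBigO_last_rpow hb0 r).congr_left (by simp))
    have h' : pohozaevField a c U =O[Filter.principal {X | ‖X‖ ≤ r ∧ 0 < X (Fin.last n)}]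
        fun X => X (Fin.last n) ^ b := by
      have hs := Asymptotics.IsBigO.sum (s := Finset.univ) fun i _ => (h i).norm_left
      refine Asymptotics.IsBigO.trans (.of_bound 1 (.of_forall fun X => ?_)) hs
      rw [one_mul, Finset.sum_apply, Real.norm_of_nonneg (Finset.sum_nonneg fun _ _ => norm_nonneg _)]
      conv_lhs => rw [← (EuclideanSpace.basisFun (Fin (n + 1)) ℝ).sum_repr (pohozaevField a c U X)]
      refine (norm_sum_le _ _).trans (Finset.sum_le_sum fun i _ => ?_)
      simp [norm_smul]
    obtain ⟨C, hC⟩ := Asymptotics.isBigO_principal.1 h'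
    refine ⟨C, fun X h1 h2 => ?_⟩
    simpa [Real.norm_of_nonneg (rpow_nonneg h2.le b)] using hC X ⟨h1, h2⟩
  · intro r hr
    obtain ⟨C, hC⟩ := Asymptotics.isBigO_principal.1 (hlastO r hr)
    exact ⟨C, fun X h1 h2 => by simpa using hC X ⟨h1, h2⟩⟩
  · exact (((hU.comp hsnocc.continuousOn hsnoc).const_mul c).add
      (continuousOn_id.inner (hg.comp hsnocc.continuousOn hsnoc))).mul hk₀
  · intro x hx
    have hc0 : Filter.Tendsto (fun t => snocE x t) (nhdsWithin 0 (Ioi 0)) (nhds (snocE x 0)) :=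
      ((continuous_snocE.comp (Continuous.prodMk_right x)).tendsto 0).mono_left nhdsWithin_le_nhds
    have hmem : ∀ᶠ t in nhdsWithin (0 : ℝ) (Ioi 0), snocE x t ∈ halfBall n ρ := by
      filter_upwards [hc0.eventually ((isOpen_lt continuous_norm continuous_const).mem_nhds
        (show snocE x 0 ∈ {X | ‖X‖ < ρ} by simpa [norm_snocE_zero] using hx)),
        self_mem_nhdsWithin] with t h1 h2
      exact ⟨h1, by simpa using h2⟩
    have hc1 : Filter.Tendsto (fun t => snocE x t) (nhdsWithin 0 (Ioi 0))
        (nhdsWithin (snocE x 0) {X | ‖X‖ ≤ ρ ∧ 0 ≤ X (Fin.last n)}) :=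
      tendsto_nhdsWithin_iff.2 ⟨hc0, hmem.mono fun t ht => ⟨ht.1.le, ht.2.le⟩⟩
    have hAt := (hAc _ (hsnoc x hx)).tendsto.comp hc1
    have hBt := (hBc _ (hsnoc x hx)).tendsto.comp hc1
    have hwt : Filter.Tendsto (fun t => w (snocE x t)) (nhdsWithin 0 (Ioi 0)) (nhds (k₀ x)) :=
      hwlim.tendsto_at hx
    have hpow : ∀ s : ℝ, 0 < s →
        Filter.Tendsto (fun t : ℝ => t ^ s) (nhdsWithin 0 (Ioi 0)) (nhds 0) := fun s hs => by
      simpa [hs.ne'] using ((continuousAt_rpow_const 0 s (Or.inr hs.le)).tendsto).mono_left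
        (nhdsWithin_le_nhds (s := Ioi 0))
    have hlim := ((hAt.mul hwt).add (((hpow (1 - a) (by linarith [hσ.1])).mul
      (hwt.pow 2)).div_const 2)).sub (((hpow (1 + a) (by linarith [hσ.2])).mul hBt).div_const 2)
    have hval : A (snocE x 0) * k₀ x + 0 * k₀ x ^ 2 / 2 - 0 * B (snocE x 0) / 2 =
        (c * U (snocE x 0) + ⟪x, g (snocE x 0)⟫) * k₀ x := by
      simp [hA, PiLp.inner_apply, mul_comm]
    rw [hval] at hlim
    refine hlim.congr' ?_
    filter_upwards [hmem] with t ht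
    simp [hlast _ ht]

end PohozaevBounds

/-- Pohozaev-type identity for the extension problem of the fractional Laplacian.
The boundary integral over the spherical part `∂''B⁺_R = {|X| = R, t > 0}` is expressed, via the
scaling `X = R•ω`, as `Rⁿ` times an integral over the open upper unit hemisphere with respect to
the surface measure `Measure.toSphere` of the unit sphere of `ℝ^{n+1}`; `ν = X/R` and
`∂U/∂ν = ⟨∇U, X⟩/R`.  The continuous extension of the horizontal gradient `∇ₓU` up to `{t = 0}`
is recorded by the function `g`. -/
theorem stmt0 (n : ℕ) (hn : 3 ≤ n) (σ R p : ℝ)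
    (hσ : σ ∈ Set.Ioo (0 : ℝ) 1) (hR : 0 < R) (hp : 0 < p)
    (K : EuclideanSpace ℝ (Fin n) → ℝ)
    (hK : ContDiffOn ℝ 1 K (closedBall (0 : EuclideanSpace ℝ (Fin n)) (2 * R)))
    (U : EuclideanSpace ℝ (Fin (n + 1)) → ℝ)
    (hU_nonneg : ∀ X : EuclideanSpace ℝ (Fin (n + 1)),
      ‖X‖ ≤ 2 * R → 0 ≤ X (Fin.last n) → 0 ≤ U X)
    (hU_cont : ContinuousOn U
      {X : EuclideanSpace ℝ (Fin (n + 1)) | ‖X‖ ≤ 2 * R ∧ 0 ≤ X (Fin.last n)})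
    (hU_C2 : ContDiffOn ℝ 2 U
      {X : EuclideanSpace ℝ (Fin (n + 1)) | ‖X‖ < 2 * R ∧ 0 < X (Fin.last n)})
    -- the equation `div(t^{1−2σ} ∇U) = 0`, in the form `t·ΔU + (1−2σ)·∂_t U = 0`:
    (hPDE : ∀ X : EuclideanSpace ℝ (Fin (n + 1)), ‖X‖ < 2 * R → 0 < X (Fin.last n) →
      X (Fin.last n) * lapl U X +
        (1 - 2 * σ) * fderiv ℝ U X (EuclideanSpace.single (Fin.last n) 1) = 0)
    -- the horizontal gradient `∇ₓU` extends continuously to `{t = 0}`: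
    (g : EuclideanSpace ℝ (Fin (n + 1)) → EuclideanSpace ℝ (Fin n))
    (hg_cont : ContinuousOn g
      {X : EuclideanSpace ℝ (Fin (n + 1)) | ‖X‖ ≤ 2 * R ∧ 0 ≤ X (Fin.last n)})
    (hg_eq : ∀ X : EuclideanSpace ℝ (Fin (n + 1)), ‖X‖ < 2 * R → 0 < X (Fin.last n) →
      ∀ i : Fin n, g X i = fderiv ℝ U X (EuclideanSpace.single i.castSucc 1))
    -- the weighted energy `t^{1−2σ}|∇U|²` is integrable on the open half-ball:
    (h_energy : IntegrableOn
      (fun X : EuclideanSpace ℝ (Fin (n + 1)) =>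
        (X (Fin.last n)) ^ (1 - 2 * σ) * ‖gradient U X‖ ^ 2)
      {X : EuclideanSpace ℝ (Fin (n + 1)) | ‖X‖ < 2 * R ∧ 0 < X (Fin.last n)} volume)
    -- the Neumann condition `t^{1−2σ} ∂_t U(x,t) → −K(x) U(x,0)^p` as `t → 0⁺`,
    -- locally uniformly for `x` in the open ball `B_{2R} ⊂ ℝⁿ`:
    (hNeumann : TendstoLocallyUniformlyOn
      (fun (t : ℝ) (x : EuclideanSpace ℝ (Fin n)) =>
        t ^ (1 - 2 * σ) * fderiv ℝ U (snocE x t) (EuclideanSpace.single (Fin.last n) 1))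
      (fun x : EuclideanSpace ℝ (Fin n) => -K x * U (snocE x 0) ^ p)
      (nhdsWithin 0 (Set.Ioi (0 : ℝ))) (ball (0 : EuclideanSpace ℝ (Fin n)) (2 * R))) :
    (∫ x in ball (0 : EuclideanSpace ℝ (Fin n)) R,
        (((n : ℝ) - 2 * σ) / 2 * K x * U (snocE x 0) ^ (p + 1) +
          ⟪x, g (snocE x 0)⟫ * K x * U (snocE x 0) ^ p)) +
      R ^ n * (∫ ω in {ω : sphere (0 : EuclideanSpace ℝ (Fin (n + 1))) 1 |
          0 < (ω : EuclideanSpace ℝ (Fin (n + 1))) (Fin.last n)},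
        (R * (ω : EuclideanSpace ℝ (Fin (n + 1))) (Fin.last n)) ^ (1 - 2 * σ) *
          (((n : ℝ) - 2 * σ) / 2 * U (R • (ω : EuclideanSpace ℝ (Fin (n + 1)))) *
              (⟪gradient U (R • (ω : EuclideanSpace ℝ (Fin (n + 1)))),
                R • (ω : EuclideanSpace ℝ (Fin (n + 1)))⟫ / R) -
            R / 2 * ‖gradient U (R • (ω : EuclideanSpace ℝ (Fin (n + 1))))‖ ^ 2 +
            R * (⟪gradient U (R • (ω : EuclideanSpace ℝ (Fin (n + 1)))),
                R • (ω : EuclideanSpace ℝ (Fin (n + 1)))⟫ / R) ^ 2)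
        ∂(volume : Measure (EuclideanSpace ℝ (Fin (n + 1)))).toSphere) = 0 := by
  have hRρ : R ∈ Ioo 0 (2 * R) := ⟨hR, by linarith⟩
  have hsnoc : ∀ x ∈ ball (0 : EuclideanSpace ℝ (Fin n)) (2 * R), snocE x 0 ∈
      {X : EuclideanSpace ℝ (Fin (n + 1)) | ‖X‖ ≤ 2 * R ∧ 0 ≤ X (Fin.last n)} := fun x hx =>
    ⟨by rw [norm_snocE_zero]; exact (mem_ball_zero_iff.1 hx).le, by simp⟩
  have hk₀ : ContinuousOn (fun x : EuclideanSpace ℝ (Fin n) => -K x * U (snocE x 0) ^ p)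
      (ball 0 (2 * R)) :=
    (hK.continuousOn.mono ball_subset_closedBall).neg.mul
      ((hU_cont.comp (continuous_snocE.comp (Continuous.prodMk_left 0)).continuousOn
        hsnoc).rpow_const fun x _ => Or.inr hp.le)
  have key := hemisphereFlux_pohozaevField hσ hRρ hU_cont hU_C2
    (fun X hX => hPDE X hX.1 hX.2) hg_cont (fun X hX => hg_eq X hX.1 hX.2) hk₀ hNeumann
  have hflat : ∫ x in ball (0 : EuclideanSpace ℝ (Fin n)) R,
      (((n : ℝ) - 2 * σ) / 2 * K x * U (snocE x 0) ^ (p + 1) +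
        ⟪x, g (snocE x 0)⟫ * K x * U (snocE x 0) ^ p) =
      -∫ x in ball (0 : EuclideanSpace ℝ (Fin n)) R,
        (((n : ℝ) - 2 * σ) / 2 * U (snocE x 0) + ⟪x, g (snocE x 0)⟫) *
          (-K x * U (snocE x 0) ^ p) := by
    rw [← integral_neg]
    refine setIntegral_congr_fun measurableSet_ball fun x hx => ?_
    have hx' := hsnoc x (ball_subset_ball hRρ.2.le hx)
    rw [rpow_add' (hU_nonneg _ hx'.1 hx'.2) (by linarith), rpow_one]
    ring
  rw [hflat, ← key, hemisphereFlux, neg_add_eq_zero]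
  congr 1
  refine setIntegral_congr_fun measurableSet_sphere_last_pos fun ω _ => ?_
  have hω : ⟪(ω : EuclideanSpace ℝ (Fin (n + 1))), (ω : EuclideanSpace ℝ (Fin (n + 1)))⟫ = 1 := by
    simp
  rw [pohozaevField, inner_smul_right, inner_sub_right, inner_smul_right, inner_smul_right,
    inner_smul_right, inner_smul_right, hω, real_inner_comm, PiLp.smul_apply, smul_eq_mul]
  field_simp
  ring
end
end

section
/- Let n ≥ 1 be an integer and σ ∈ (0,1) with n > 2σ. Let M ∈ ℝ and let α be a real-valued continuously differentiable function on a neighborhood of the origin in the closed half-space ℝⁿ × [0,∞) with α(0) = 0. Define U(X) = |X|^{2σ−n} + M + α(X) for X = (x,t) with t ≥ 0 and X ≠ 0. For δ > 0 let ∂''B⁺_δ = {X ∈ ℝ^{n+1} : |X| = δ, t > 0}, let ν = X/δ be the outward unit normal, ∂U/∂ν = ⟨∇U, ν⟩, and set B''(X,U,∇U,δ,σ) = ((n−2σ)/2) U ∂U/∂ν − (δ/2)|∇U|² + δ |∂U/∂ν|². Then lim_{δ→0⁺} ∫_{∂''B⁺_δ} t^{1−2σ} B''(X,U,∇U,δ,σ)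 dS = −((n−2σ)²/4) · M · |𝕊^{n−1}| · B(n/2, 1−σ), where dS is the n-dimensional surface measure, |𝕊^{n−1}| is the total surface measure of the unit sphere in ℝⁿ, and B(·,·) denotes the Beta function. -/
open MeasureTheory Real Set Metric
open scoped RealInnerProductSpace

noncomputable section

/-- Integration in polar coordinates of a function that splits into an angular and a radial
factor. -/
lemma integral_eq_toSphere_mul_of_smul {E : Type*} [NormedAddCommGroup E] [NormedSpace ℝ E]
    [MeasurableSpace E] [BorelSpace E] [FiniteDimensional ℝ E] [Nontrivial E] (μ : Measure E)
    [μ.IsAddHaarMeasure] (f : E → ℝ) (g : sphere (0 : E) 1 → ℝ) (h : ℝ → ℝ)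
    (hf : ∀ (ω : sphere (0 : E) 1) (r : ℝ), 0 < r → f (r • (ω : E)) = g ω * h r) :
    ∫ x, f x ∂μ = (∫ ω, g ω ∂μ.toSphere) *
      ∫ r in Ioi (0 : ℝ), r ^ (Module.finrank ℝ E - 1) * h r := by
  have hradial : ∫ r : Ioi (0 : ℝ), h r ∂(Measure.volumeIoiPow (Module.finrank ℝ E - 1)) =
      ∫ r in Ioi (0 : ℝ), r ^ (Module.finrank ℝ E - 1) * h r := by
    simp only [Measure.volumeIoiPow, ENNReal.ofReal]
    rw [integral_withDensity_eq_integral_smul,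
      integral_subtype_comap measurableSet_Ioi
        fun a ↦ Real.toNNReal (a ^ (Module.finrank ℝ E - 1)) • h a,
      setIntegral_congr_fun measurableSet_Ioi fun x hx ↦ ?_]
    · simp only [NNReal.smul_def, smul_eq_mul]
      rw [Real.coe_toNNReal _ (pow_nonneg (mem_Ioi.1 hx).le _)]
    · exact (measurable_subtype_coe.pow_const _).real_toNNReal
  have hpunctured : ∫ x, f x ∂μ = ∫ x : ({0}ᶜ : Set E), f x ∂(μ.comap (↑)) := by
    rw [integral_subtype_comap (measurableSet_singleton _).compl f,
      restrict_compl_singleton]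
  rw [← hradial, ← integral_prod_mul, hpunctured,
    ← μ.measurePreserving_homeomorphUnitSphereProd.integral_comp
      (Homeomorph.measurableEmbedding _) (fun z => g z.1 * h z.2)]
  congr with x
  have hx := hf (homeomorphUnitSphereProd E x).1
    (homeomorphUnitSphereProd E x).2
    (homeomorphUnitSphereProd E x).2.2
  have hsymm := congrArg Subtype.val ((homeomorphUnitSphereProd E).symm_apply_apply x)
  rw [homeomorphUnitSphereProd_symm_apply_coe] at hsymm
  rw [← hx, hsymm]

/-- The Gaussian integral of `t ^ s` over the upper half-space, where `t` is the last
coordinate. -/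
lemma integral_halfSpace_rpow_mul_exp (n : ℕ) {s : ℝ} (hs : -1 < s) :
    ∫ X : EuclideanSpace ℝ (Fin (n + 1)),
      (if 0 < X (Fin.last n) then X (Fin.last n) ^ s else 0) * Real.exp (-‖X‖ ^ 2) =
      √π ^ n * (Real.Gamma ((s + 1) / 2) / 2) := by
  let φ : Fin (n + 1) → ℝ → ℝ := fun i x =>
    (if i = Fin.last n then (if 0 < x then x ^ s else 0) else 1) * Real.exp (-x ^ 2)
  have hφ : ∀ X : EuclideanSpace ℝ (Fin (n + 1)),
      (if 0 < X (Fin.last n) then X (Fin.last n) ^ s else 0) * Real.exp (-‖X‖ ^ 2) =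
      ∏ i, φ i (WithLp.ofLp X i) := by
    intro X
    simp only [φ, Finset.prod_mul_distrib, Finset.prod_ite_eq', Finset.mem_univ, if_true]
    rw [← Real.exp_sum, EuclideanSpace.real_norm_sq_eq, Finset.sum_neg_distrib]
  simp_rw [hφ]
  rw [(PiLp.volume_preserving_ofLp (Fin (n + 1))).integral_comp
      (MeasurableEquiv.toLp 2 _).symm.measurableEmbedding (fun y => ∏ i, φ i (y i)),
    integral_fintype_prod_volume_eq_prod, Fin.prod_univ_castSucc]
  have hgauss : ∫ x : ℝ, Real.exp (-x ^ 2) = √π := by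
    simpa using integral_gaussian 1
  have hlast : ∫ x : ℝ, φ (Fin.last n) x = Real.Gamma ((s + 1) / 2) / 2 := by
    have h1 : ∀ x, φ (Fin.last n) x =
        (Ioi (0 : ℝ)).indicator (fun x => x ^ s * Real.exp (-x ^ (2 : ℝ))) x := by
      intro x
      by_cases hx : 0 < x <;> simp [φ, hx]
    simp_rw [h1]
    rw [integral_indicator measurableSet_Ioi, integral_rpow_mul_exp_neg_rpow two_pos hs]
    ring
  rw [hlast]
  have hcast : ∀ i : Fin n, ∫ x : ℝ, φ i.castSucc x = √π := by
    intro i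
    simp [φ, (Fin.castSucc_lt_last i).ne, hgauss]
  simp [hcast]

/-- The integral over the upper unit hemisphere of a power of the last coordinate. -/
lemma setIntegral_hemisphere_rpow (n : ℕ) {s : ℝ} (hs : -1 < s) :
    ∫ ω in {ω : sphere (0 : EuclideanSpace ℝ (Fin (n + 1))) 1 |
        0 < (ω : EuclideanSpace ℝ (Fin (n + 1))) (Fin.last n)},
      (ω : EuclideanSpace ℝ (Fin (n + 1))) (Fin.last n) ^ s
      ∂(volume : Measure (EuclideanSpace ℝ (Fin (n + 1)))).toSphere =
    √π ^ n * Real.Gamma ((s + 1) / 2) / Real.Gamma (((n : ℝ) + s + 1) / 2) := by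
  have hmeas : MeasurableSet {ω : sphere (0 : EuclideanSpace ℝ (Fin (n + 1))) 1 |
        0 < (ω : EuclideanSpace ℝ (Fin (n + 1))) (Fin.last n)} :=
    measurableSet_lt measurable_const (by fun_prop)
  have hpolar := integral_eq_toSphere_mul_of_smul
    (volume : Measure (EuclideanSpace ℝ (Fin (n + 1))))
    (fun X => (if 0 < X (Fin.last n) then X (Fin.last n) ^ s else 0) * Real.exp (-‖X‖ ^ 2))
    ({ω : sphere (0 : EuclideanSpace ℝ (Fin (n + 1))) 1 |
        0 < (ω : EuclideanSpace ℝ (Fin (n + 1))) (Fin.last n)}.indicator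
      fun ω => (ω : EuclideanSpace ℝ (Fin (n + 1))) (Fin.last n) ^ s)
    (fun r => r ^ s * Real.exp (-r ^ 2)) (by
      intro ω r hr
      have hω : ‖(ω : EuclideanSpace ℝ (Fin (n + 1)))‖ = 1 := norm_eq_of_mem_sphere ω
      by_cases h : 0 < (ω : EuclideanSpace ℝ (Fin (n + 1))) (Fin.last n)
      · simp [indicator, norm_smul, hω, hr, h, Real.mul_rpow hr.le h.le]
        ring
      · simp [indicator, hr, h])
  rw [integral_halfSpace_rpow_mul_exp n hs, integral_indicator hmeas,
    finrank_euclideanSpace_fin, Nat.add_sub_cancel] at hpolar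
  have hn : (0 : ℝ) ≤ n := n.cast_nonneg
  have hrad : ∫ r in Ioi (0 : ℝ), r ^ n * (r ^ s * Real.exp (-r ^ 2)) =
      Real.Gamma (((n : ℝ) + s + 1) / 2) / 2 := by
    have := integral_rpow_mul_exp_neg_rpow (p := 2) (q := n + s) two_pos (by linarith)
    rw [one_div_mul_eq_div] at this
    rw [← this]
    refine setIntegral_congr_fun measurableSet_Ioi fun r hr => ?_
    simp only [Real.rpow_two]
    rw [Real.rpow_add (mem_Ioi.1 hr), Real.rpow_natCast]
    ring
  rw [hrad] at hpolar
  have hΓ : 0 < Real.Gamma (((n : ℝ) + s + 1) / 2) := Real.Gamma_pos_of_pos (by linarith)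
  rw [eq_div_iff hΓ.ne']
  linarith

lemma integrableOn_hemisphere_rpow (n : ℕ) {s : ℝ} (hs : -1 < s) :
    IntegrableOn (fun ω : sphere (0 : EuclideanSpace ℝ (Fin (n + 1))) 1 =>
        (ω : EuclideanSpace ℝ (Fin (n + 1))) (Fin.last n) ^ s)
      {ω | 0 < (ω : EuclideanSpace ℝ (Fin (n + 1))) (Fin.last n)}
      (volume : Measure (EuclideanSpace ℝ (Fin (n + 1)))).toSphere := by
  by_contra h
  have hn : (0 : ℝ) ≤ n := n.cast_nonneg
  have h0 := setIntegral_hemisphere_rpow n hs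
  rw [integral_undef h] at h0
  have hpos : 0 < √π ^ n * Real.Gamma ((s + 1) / 2) / Real.Gamma (((n : ℝ) + s + 1) / 2) :=
    div_pos (mul_pos (by positivity) (Real.Gamma_pos_of_pos (by linarith)))
      (Real.Gamma_pos_of_pos (by linarith))
  exact hpos.ne h0

lemma toReal_toSphere_univ_euclideanSpace {n : ℕ} (hn : 1 ≤ n) :
    ((volume : Measure (EuclideanSpace ℝ (Fin n))).toSphere Set.univ).toReal =
      2 * √π ^ n / Real.Gamma ((n : ℝ) / 2) := by
  have : Nonempty (Fin n) := ⟨⟨0, hn⟩⟩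
  have hn' : (0 : ℝ) < n := by exact_mod_cast hn
  have hΓ : 0 < Real.Gamma ((n : ℝ) / 2) := Real.Gamma_pos_of_pos (by positivity)
  rw [Measure.toSphere_apply_univ, EuclideanSpace.volume_ball, finrank_euclideanSpace_fin,
    Fintype.card_fin, Real.Gamma_add_one (by positivity), ENNReal.ofReal_one, one_pow, one_mul,
    ENNReal.toReal_mul, ENNReal.toReal_natCast, ENNReal.toReal_ofReal (by positivity)]
  field_simp

/-- Convergence of integrals under a uniform bound relative to an integrable weight. -/
lemma tendsto_integral_of_abs_sub_le_mul {Ω ι : Type*} [MeasurableSpace Ω] {μ : Measure Ω}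
    {l : Filter ι} {w : Ω → ℝ} (hw : Integrable w μ) (c : ℝ) {F : ι → Ω → ℝ} {H : ι → ℝ}
    (hF : ∀ᶠ i in l, AEStronglyMeasurable (F i) μ)
    (hH : Filter.Tendsto H l (nhds 0))
    (hbound : ∀ᶠ i in l, ∀ᵐ ω ∂μ, |F i ω - c * w ω| ≤ H i * w ω) :
    Filter.Tendsto (fun i => ∫ ω, F i ω ∂μ) l (nhds (c * ∫ ω, w ω ∂μ)) := by
  rw [tendsto_iff_norm_sub_tendsto_zero]
  have hlim : Filter.Tendsto (fun i => H i * ∫ ω, w ω ∂μ) l (nhds 0) := by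
    simpa using hH.mul_const (∫ ω, w ω ∂μ)
  refine squeeze_zero' (Filter.Eventually.of_forall fun i => norm_nonneg _) ?_ hlim
  filter_upwards [hF, hbound] with i hFi hbi
  have hdiff : Integrable (fun ω => F i ω - c * w ω) μ :=
    (hw.const_mul (H i)).mono' (hFi.sub (hw.const_mul c).aestronglyMeasurable) hbi
  have hFint : Integrable (F i) μ := by
    simpa [Pi.add_def] using hdiff.add (hw.const_mul c)
  rw [← integral_const_mul, ← integral_const_mul, ← integral_sub hFint (hw.const_mul c)]
  exact norm_integral_le_of_norm_le (hw.const_mul (H i)) hbi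

/-- The gradient of a power of the norm away from the origin. -/
lemma hasGradientAt_norm_rpow_of_ne_zero {E : Type*} [NormedAddCommGroup E]
    [InnerProductSpace ℝ E] [CompleteSpace E] (p : ℝ) {x : E} (hx : x ≠ 0) :
    HasGradientAt (fun y : E => ‖y‖ ^ p) ((p * ‖x‖ ^ (p - 2)) • x) x := by
  have hpos : 0 < ‖x‖ := norm_pos_iff.2 hx
  have h := ((hasFDerivAt_id x).norm_sq).rpow_const (p := p / 2) (Or.inl (by simpa using hx))
  have heq : ∀ y : E, (‖id y‖ ^ 2) ^ (p / 2) = ‖y‖ ^ p := by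
    intro y
    rw [id, ← Real.rpow_natCast, ← Real.rpow_mul (norm_nonneg y)]
    congr 1
    push_cast
    ring
  simp_rw [heq] at h
  rw [hasGradientAt_iff_hasFDerivAt]
  have hexp : (‖x‖ ^ 2) ^ (p / 2 - 1) = ‖x‖ ^ (p - 2) := by
    rw [← Real.rpow_natCast, ← Real.rpow_mul (norm_nonneg x)]
    congr 1
    push_cast
    ring
  refine h.congr_fderiv ?_
  ext y
  simp [hexp]
  ring

/-- A function that is `C¹` up to the flat boundary of a half-ball and vanishes at the origin has
bounded gradient and grows at most linearly near the origin. -/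
lemma exists_gradient_bound_of_contDiffOn_halfBall {n : ℕ}
    {α : EuclideanSpace ℝ (Fin (n + 1)) → ℝ} {ε : ℝ} (hε : 0 < ε)
    (hα : ContDiffOn ℝ 1 α
      {X : EuclideanSpace ℝ (Fin (n + 1)) | ‖X‖ < ε ∧ 0 ≤ X (Fin.last n)})
    (hα0 : α 0 = 0) :
    ∃ K r : ℝ, 0 ≤ K ∧ 0 < r ∧ ∀ X : EuclideanSpace ℝ (Fin (n + 1)), ‖X‖ < r →
      0 < X (Fin.last n) → DifferentiableAt ℝ α X ∧ ‖gradient α X‖ ≤ K ∧ |α X| ≤ K * ‖X‖ := by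
  set S : Set (EuclideanSpace ℝ (Fin (n + 1))) := {X | ‖X‖ < ε ∧ 0 ≤ X (Fin.last n)} with hS
  have h0S : (0 : EuclideanSpace ℝ (Fin (n + 1))) ∈ S := by simp [hS, hε]
  have hconv : Convex ℝ S := by
    intro X hX Y hY a b ha hb hab
    refine ⟨?_, ?_⟩
    · simpa using convex_ball (0 : EuclideanSpace ℝ (Fin (n + 1))) ε
        (by simpa using hX.1) (by simpa using hY.1) ha hb hab
    · have hX2 := hX.2
      have hY2 := hY.2
      simp only [PiLp.add_apply, PiLp.smul_apply, smul_eq_mul]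
      positivity
  obtain ⟨K, t, ht, hLip⟩ := (hα 0 h0S).exists_lipschitzOnWith hconv
  obtain ⟨η, hη, hηt⟩ := Metric.mem_nhdsWithin_iff.1 ht
  refine ⟨K, min η ε, K.2, lt_min hη hε, fun X hXr hXpos => ?_⟩
  set V : Set (EuclideanSpace ℝ (Fin (n + 1))) := {Y | ‖Y‖ < min η ε ∧ 0 < Y (Fin.last n)}
    with hV
  have hVo : IsOpen V :=
    (isOpen_lt continuous_norm continuous_const).inter (isOpen_lt continuous_const
      (by fun_prop : Continuous fun Y : EuclideanSpace ℝ (Fin (n + 1)) => Y (Fin.last n)))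
  have hVX : V ∈ nhds X := hVo.mem_nhds ⟨hXr, hXpos⟩
  have hVS : V ⊆ S := fun Y hY => ⟨hY.1.trans_le (min_le_right _ _), hY.2.le⟩
  have hVt : V ⊆ t := fun Y hY =>
    hηt ⟨by simpa using hY.1.trans_le (min_le_left _ _), hVS hY⟩
  refine ⟨?_, ?_, ?_⟩
  · exact ((hα X (hVS ⟨hXr, hXpos⟩)).contDiffAt (Filter.mem_of_superset hVX hVS)).differentiableAt
      one_ne_zero
  · rw [gradient, LinearIsometryEquiv.norm_map]
    exact norm_fderiv_le_of_lipschitzOn ℝ hVX (hLip.mono hVt)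
  · have h := hLip.norm_sub_le (hVt ⟨hXr, hXpos⟩) (hηt ⟨mem_ball_self hη, h0S⟩)
    simpa [hα0] using h

/-- The weighted Pohozaev density, after cancellation of its leading singular terms. -/
lemma pohozaev_density_sub_eq {δ w p s M A γ N : ℝ} {n : ℕ} (hδ : 0 < δ) (hw : 0 < w)
    (hs : n + s = 1 - p) :
    δ ^ n * ((δ * w) ^ s * (-p / 2 * (δ ^ p + M + A) * (p * δ ^ (p - 1) + γ) -
        δ / 2 * ((p * δ ^ (p - 1)) ^ 2 + 2 * (p * δ ^ (p - 1)) * γ + N) +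
        δ * (p * δ ^ (p - 1) + γ) ^ 2)) - -(p ^ 2 / 2) * M * w ^ s =
      w ^ s * (-(p ^ 2 / 2) * A + p / 2 * δ * γ - p / 2 * (M + A) * γ * δ ^ (1 - p) +
        δ ^ (2 - p) * (γ ^ 2 - N / 2)) := by
  have hP : 0 < δ ^ p := Real.rpow_pos_of_pos hδ p
  have h1 : δ ^ n * δ ^ s = δ / δ ^ p := by
    rw [← Real.rpow_natCast, ← Real.rpow_add hδ, hs, Real.rpow_sub hδ, Real.rpow_one]
  have h2 : δ ^ (2 - p) = δ ^ 2 / δ ^ p := by rw [Real.rpow_sub hδ, Real.rpow_two]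
  rw [Real.mul_rpow hδ.le hw.le, mul_assoc (δ ^ s), ← mul_assoc, h1, h2, Real.rpow_sub hδ 1 p,
    Real.rpow_sub hδ p 1, Real.rpow_one]
  field_simp
  ring

lemma abs_pohozaev_remainder_le {δ p M A γ N K : ℝ} (hδ : 0 < δ) (hK : 0 ≤ K)
    (hA : |A| ≤ K * δ) (hγ : |γ| ≤ K) (hN0 : 0 ≤ N) (hN : N ≤ K ^ 2) :
    |-(p ^ 2 / 2) * A + p / 2 * δ * γ - p / 2 * (M + A) * γ * δ ^ (1 - p) +
        δ ^ (2 - p) * (γ ^ 2 - N / 2)| ≤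
      p ^ 2 / 2 * (K * δ) + |p| / 2 * δ * K + |p| / 2 * (|M| + K * δ) * K * δ ^ (1 - p) +
        δ ^ (2 - p) * (2 * K ^ 2) := by
  have hq : 0 < δ ^ (1 - p) := Real.rpow_pos_of_pos hδ _
  have hq' : 0 < δ ^ (2 - p) := Real.rpow_pos_of_pos hδ _
  have hγ2 : γ ^ 2 ≤ K ^ 2 := sq_le_sq' (abs_le.1 hγ).1 (abs_le.1 hγ).2
  have e1 : |-(p ^ 2 / 2) * A| ≤ p ^ 2 / 2 * (K * δ) := by
    rw [abs_mul, abs_neg, abs_of_nonneg (by positivity)]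
    gcongr
  have e2 : |p / 2 * δ * γ| ≤ |p| / 2 * δ * K := by
    rw [abs_mul, abs_mul, abs_div, abs_of_pos hδ, abs_two]
    gcongr
  have e3 : |p / 2 * (M + A) * γ * δ ^ (1 - p)| ≤
      |p| / 2 * (|M| + K * δ) * K * δ ^ (1 - p) := by
    rw [abs_mul, abs_mul, abs_mul, abs_div, abs_of_pos hq, abs_two]
    gcongr
    exact (abs_add_le M A).trans (by gcongr)
  have e4 : |δ ^ (2 - p) * (γ ^ 2 - N / 2)| ≤ δ ^ (2 - p) * (2 * K ^ 2) := by
    rw [abs_mul, abs_of_pos hq']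
    gcongr
    rw [abs_le]
    constructor <;> nlinarith [sq_nonneg γ, sq_nonneg K]
  refine (abs_add_le _ _).trans (add_le_add ?_ e4)
  exact (abs_sub _ _).trans (add_le_add ((abs_add_le _ _).trans (add_le_add e1 e2)) e3)

/-- Limiting flux of the Pohozaev boundary term for `U(X) = |X|^{2σ−n} + M + α(X)`
(Proposition 2.2).  The boundary integral over `∂''B⁺_δ = {|X| = δ, t > 0}` is expressed, via
the scaling `X = δ•ω`, as `δⁿ` times an integral over the open upper unit hemisphere with
respect to the surface measure `Measure.toSphere` of the unit sphere of `ℝ^{n+1}`; `ν = X/δ`,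
`∂U/∂ν = ⟨∇U, X⟩/δ`, and
`B'' = ((n−2σ)/2)·U·∂U/∂ν − (δ/2)|∇U|² + δ|∂U/∂ν|²`.  The right-hand side is
`−((n−2σ)²/4)·M·|𝕊^{n−1}|·B(n/2, 1−σ)`, with `|𝕊^{n−1}|` the total surface measure of the unit
sphere of `ℝⁿ` and `B(a,b) = Γ(a)Γ(b)/Γ(a+b)` the Beta function.  The perturbation `α` is `C¹`
on a neighborhood of the origin in the closed half-space `{t ≥ 0}` with `α(0) = 0`. -/
theorem stmt1 (n : ℕ) (hn : 1 ≤ n) (σ : ℝ) (hσ : σ ∈ Set.Ioo (0 : ℝ) 1)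
    (hnσ : 2 * σ < (n : ℝ)) (M : ℝ)
    (α : EuclideanSpace ℝ (Fin (n + 1)) → ℝ) (ε : ℝ) (hε : 0 < ε)
    (hα : ContDiffOn ℝ 1 α
      {X : EuclideanSpace ℝ (Fin (n + 1)) | ‖X‖ < ε ∧ 0 ≤ X (Fin.last n)})
    (hα0 : α 0 = 0)
    (U : EuclideanSpace ℝ (Fin (n + 1)) → ℝ)
    (hU : ∀ X : EuclideanSpace ℝ (Fin (n + 1)), X ≠ 0 →
      U X = ‖X‖ ^ (2 * σ - (n : ℝ)) + M + α X) :
    Filter.Tendsto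
      (fun δ : ℝ => δ ^ n * (∫ ω in {ω : sphere (0 : EuclideanSpace ℝ (Fin (n + 1))) 1 |
          0 < (ω : EuclideanSpace ℝ (Fin (n + 1))) (Fin.last n)},
        (δ * (ω : EuclideanSpace ℝ (Fin (n + 1))) (Fin.last n)) ^ (1 - 2 * σ) *
          (((n : ℝ) - 2 * σ) / 2 * U (δ • (ω : EuclideanSpace ℝ (Fin (n + 1)))) *
              (⟪gradient U (δ • (ω : EuclideanSpace ℝ (Fin (n + 1)))),
                δ • (ω : EuclideanSpace ℝ (Fin (n + 1)))⟫ / δ) -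
            δ / 2 * ‖gradient U (δ • (ω : EuclideanSpace ℝ (Fin (n + 1))))‖ ^ 2 +
            δ * (⟪gradient U (δ • (ω : EuclideanSpace ℝ (Fin (n + 1)))),
                δ • (ω : EuclideanSpace ℝ (Fin (n + 1)))⟫ / δ) ^ 2)
        ∂(volume : Measure (EuclideanSpace ℝ (Fin (n + 1)))).toSphere))
      (nhdsWithin 0 (Set.Ioi (0 : ℝ)))
      (nhds (-(((n : ℝ) - 2 * σ) ^ 2 / 4) * M *
        ((volume : Measure (EuclideanSpace ℝ (Fin n))).toSphere Set.univ).toReal *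
        (Real.Gamma ((n : ℝ) / 2) * Real.Gamma (1 - σ) /
          Real.Gamma ((n : ℝ) / 2 + (1 - σ))))) := by
  have hp : 2 * σ - (n : ℝ) < 0 := by linarith
  set p : ℝ := 2 * σ - (n : ℝ) with hp_def
  obtain ⟨K, r, hK, hr, hKr⟩ := exists_gradient_bound_of_contDiffOn_halfBall hε hα hα0
  set D : Set (sphere (0 : EuclideanSpace ℝ (Fin (n + 1))) 1) :=
    {ω | 0 < (ω : EuclideanSpace ℝ (Fin (n + 1))) (Fin.last n)} with hD
  have hDm : MeasurableSet D := measurableSet_lt measurable_const (by fun_prop)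
  have hs : -1 < 1 - 2 * σ := by linarith [hσ.2]
  have hval : -(((n : ℝ) - 2 * σ) ^ 2 / 4) * M *
        ((volume : Measure (EuclideanSpace ℝ (Fin n))).toSphere Set.univ).toReal *
        (Real.Gamma ((n : ℝ) / 2) * Real.Gamma (1 - σ) /
          Real.Gamma ((n : ℝ) / 2 + (1 - σ))) = -(p ^ 2 / 2) * M *
      ∫ ω in D, (ω : EuclideanSpace ℝ (Fin (n + 1))) (Fin.last n) ^ (1 - 2 * σ)
        ∂(volume : Measure (EuclideanSpace ℝ (Fin (n + 1)))).toSphere := by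
    have hn' : (0 : ℝ) < n := by exact_mod_cast hn
    have hΓ : 0 < Real.Gamma ((n : ℝ) / 2) := Real.Gamma_pos_of_pos (by positivity)
    rw [setIntegral_hemisphere_rpow n hs, toReal_toSphere_univ_euclideanSpace hn,
      show ((1 - 2 * σ + 1) / 2 : ℝ) = 1 - σ by ring,
      show (((n : ℝ) + (1 - 2 * σ) + 1) / 2 : ℝ) = n / 2 + (1 - σ) by ring, hp_def]
    field_simp
    ring
  simp_rw [← integral_const_mul]
  rw [hval]
  have hsmall : ∀ᶠ δ : ℝ in nhdsWithin 0 (Set.Ioi (0 : ℝ)), 0 < δ ∧ δ < min r ε :=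
    Ioo_mem_nhdsGT (lt_min hr hε)
  have hnorm : ∀ {δ : ℝ}, 0 < δ → ∀ ω : sphere (0 : EuclideanSpace ℝ (Fin (n + 1))) 1,
      ‖δ • (ω : EuclideanSpace ℝ (Fin (n + 1)))‖ = δ := fun {δ} hδ ω => by
    rw [norm_smul, norm_eq_of_mem_sphere ω, mul_one, Real.norm_of_nonneg hδ.le]
  have hlast : ∀ {δ : ℝ}, 0 < δ → ∀ ω ∈ D,
      0 < (δ • (ω : EuclideanSpace ℝ (Fin (n + 1)))) (Fin.last n) := fun {δ} hδ ω hω => by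
    simpa using mul_pos hδ hω
  refine tendsto_integral_of_abs_sub_le_mul (integrableOn_hemisphere_rpow n hs)
    (-(p ^ 2 / 2) * M)
    (H := fun δ => p ^ 2 / 2 * (K * δ) + |p| / 2 * δ * K +
      |p| / 2 * (|M| + K * δ) * K * δ ^ (1 - p) + δ ^ (2 - p) * (2 * K ^ 2)) ?_ ?_ ?_
  · filter_upwards [hsmall] with δ hδ
    have hUm : AEStronglyMeasurable
        (fun ω : sphere (0 : EuclideanSpace ℝ (Fin (n + 1))) 1 =>
          U (δ • (ω : EuclideanSpace ℝ (Fin (n + 1)))))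
        ((volume : Measure (EuclideanSpace ℝ (Fin (n + 1)))).toSphere.restrict D) := by
      refine ContinuousOn.aestronglyMeasurable ?_ hDm
      have hcα : ContinuousOn (fun ω : sphere (0 : EuclideanSpace ℝ (Fin (n + 1))) 1 =>
          δ ^ p + M + α (δ • (ω : EuclideanSpace ℝ (Fin (n + 1))))) D := by
        refine continuousOn_const.add (hα.continuousOn.comp (by fun_prop) fun ω hω => ?_)
        refine ⟨?_, (hlast hδ.1 ω hω).le⟩
        rw [hnorm hδ.1]
        exact hδ.2.trans_le (min_le_right _ _)
      refine hcα.congr fun ω hω => ?_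
      rw [hU _ (norm_pos_iff.1 (by rw [hnorm hδ.1]; exact hδ.1)), hnorm hδ.1]
    have hgm : Measurable fun ω : sphere (0 : EuclideanSpace ℝ (Fin (n + 1))) 1 =>
        gradient U (δ • (ω : EuclideanSpace ℝ (Fin (n + 1)))) := by
      have : Measurable (gradient U) :=
        (InnerProductSpace.toDual ℝ _).symm.continuous.measurable.comp (measurable_fderiv ℝ U)
      exact this.comp (by fun_prop)
    have hwm : Measurable fun ω : sphere (0 : EuclideanSpace ℝ (Fin (n + 1))) 1 =>
        (δ * (ω : EuclideanSpace ℝ (Fin (n + 1))) (Fin.last n)) ^ (1 - 2 * σ) :=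
      Measurable.pow_const (by fun_prop) _
    have him : Measurable fun ω : sphere (0 : EuclideanSpace ℝ (Fin (n + 1))) 1 =>
        ⟪gradient U (δ • (ω : EuclideanSpace ℝ (Fin (n + 1)))),
          δ • (ω : EuclideanSpace ℝ (Fin (n + 1)))⟫ / δ :=
      (hgm.inner (by fun_prop)).div_const δ
    refine AEStronglyMeasurable.const_mul (hwm.aestronglyMeasurable.mul ?_) _
    refine (((hUm.const_mul _).mul him.aestronglyMeasurable).sub ?_).add ?_
    · exact ((hgm.norm.pow_const 2).const_mul _).aestronglyMeasurable
    · exact ((him.pow_const 2).const_mul _).aestronglyMeasurable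
  · have hcont : Continuous fun δ : ℝ => p ^ 2 / 2 * (K * δ) + |p| / 2 * δ * K +
        |p| / 2 * (|M| + K * δ) * K * δ ^ (1 - p) + δ ^ (2 - p) * (2 * K ^ 2) := by
      have h1 : Continuous fun δ : ℝ => δ ^ (1 - p) :=
        Real.continuous_rpow_const (by linarith)
      have h2 : Continuous fun δ : ℝ => δ ^ (2 - p) :=
        Real.continuous_rpow_const (by linarith)
      fun_prop
    have h0 := (hcont.tendsto 0).mono_left (nhdsWithin_le_nhds (s := Ioi (0 : ℝ)))
    simpa [Real.zero_rpow (show 1 - p ≠ 0 by linarith),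
      Real.zero_rpow (show 2 - p ≠ 0 by linarith)] using h0
  · filter_upwards [hsmall] with δ hδ
    filter_upwards [ae_restrict_mem hDm] with ω hω
    have hδ0 := hδ.1
    set X : EuclideanSpace ℝ (Fin (n + 1)) := δ • (ω : EuclideanSpace ℝ (Fin (n + 1))) with hX
    have hXn : ‖X‖ = δ := hnorm hδ0 ω
    have hX0 : X ≠ 0 := norm_pos_iff.1 (hXn.symm ▸ hδ0)
    obtain ⟨hdiff, hgK, hαK⟩ := hKr X (hXn.symm ▸ hδ.2.trans_le (min_le_left _ _))
      (hlast hδ0 ω hω)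
    have hωn : ‖(ω : EuclideanSpace ℝ (Fin (n + 1)))‖ = 1 := norm_eq_of_mem_sphere ω
    have hgrad : gradient U X =
        (p * δ ^ (p - 1)) • (ω : EuclideanSpace ℝ (Fin (n + 1))) + gradient α X := by
      have h := ((hasGradientAt_norm_rpow_of_ne_zero p hX0).hasFDerivAt.add_const M).add
        hdiff.hasGradientAt.hasFDerivAt
      have hev : U =ᶠ[nhds X] fun Y => ‖Y‖ ^ p + M + α Y := by
        filter_upwards [isOpen_ne.mem_nhds hX0] with Y hY using hU Y hY
      have h' := (h.congr_of_eventuallyEq hev).hasGradientAt.gradient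
      rw [h', map_add, LinearIsometryEquiv.symm_apply_apply, LinearIsometryEquiv.symm_apply_apply,
        hXn, hX, smul_smul, mul_assoc, ← Real.rpow_add_one hδ0.ne']
      congr 4
      ring
    set γ : ℝ := ⟪gradient α X, (ω : EuclideanSpace ℝ (Fin (n + 1)))⟫ with hγ
    have hinner : ⟪gradient U X, X⟫ / δ = p * δ ^ (p - 1) + γ := by
      rw [hX, inner_smul_right, ← hX, mul_div_cancel_left₀ _ hδ0.ne', hgrad, inner_add_left,
        real_inner_smul_left, real_inner_self_eq_norm_sq, hωn]
      ring
    have hnsq : ‖gradient U X‖ ^ 2 =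
        (p * δ ^ (p - 1)) ^ 2 + 2 * (p * δ ^ (p - 1)) * γ + ‖gradient α X‖ ^ 2 := by
      rw [hgrad, norm_add_sq_real, norm_smul, hωn, mul_one, Real.norm_eq_abs, sq_abs,
        real_inner_smul_left, real_inner_comm, ← hγ]
      ring
    have hγK : |γ| ≤ K := by
      refine (abs_real_inner_le_norm _ _).trans ?_
      rwa [hωn, mul_one]
    rw [hinner, hnsq, hU X hX0, hXn, show ((n : ℝ) - 2 * σ) / 2 = -p / 2 by rw [hp_def]; ring,
      pohozaev_density_sub_eq hδ0 hω (by rw [hp_def]; ring), abs_mul,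
      abs_of_pos (Real.rpow_pos_of_pos hω _), mul_comm]
    gcongr
    exact abs_pohozaev_remainder_le hδ0 hK (hXn ▸ hαK) hγK (by positivity) (by gcongr)
end
end

section
/- For every real number α ≥ 2 there exists a positive constant C, depending only on α, such that for all real numbers a ≥ 0 and b, one has | |a+b|^{α−1}(a+b) − a^α − α a^{α−1} b − (α(α−1)/2) a^{α−2} b² | ≤ C ( |b|^α + a^γ |b|^{α−γ} ), where γ = max{0, α−3}. -/
open Real

lemma abs_le_mul_abs_pow_succ_of_hasDerivAt {f f' : ℝ → ℝ} {r K : ℝ} {n : ℕ}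
    (hd : ∀ t, |t| ≤ r → HasDerivAt f (f' t) t) (h0 : f 0 = 0) (hK : 0 ≤ K)
    (hb : ∀ t, |t| ≤ r → |f' t| ≤ K * |t| ^ n) :
    ∀ t, |t| ≤ r → |f t| ≤ K * |t| ^ (n + 1) := by
  intro t ht
  have hs : ∀ x ∈ Metric.closedBall (0 : ℝ) |t|, |x| ≤ |t| := fun x hx => by
    simpa [Real.dist_eq] using hx
  have h := (convex_closedBall (0 : ℝ) |t|).norm_image_sub_le_of_norm_hasDerivWithin_le
    (f := f) (f' := f') (C := K * |t| ^ n) (x := 0) (y := t)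
    (fun x hx => (hd x ((hs x hx).trans ht)).hasDerivWithinAt)
    (fun x hx => (hb x ((hs x hx).trans ht)).trans (by have := hs x hx; gcongr))
    (by simp) (by simp)
  simpa [h0, pow_succ, mul_assoc] using h

lemma exists_abs_one_add_rpow_sub_taylor_le (α : ℝ) :
    ∃ K, 0 ≤ K ∧ ∀ t : ℝ, |t| ≤ 1 / 2 →
      |(1 + t) ^ α - 1 - α * t - (α * (α - 1) / 2) * t ^ 2| ≤ K * |t| ^ 3 := by
  have hpos : ∀ t : ℝ, |t| ≤ 1 / 2 → 0 < 1 + t := fun t ht => by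
    linarith [(abs_le.1 ht).1]
  have hder : ∀ p t : ℝ, |t| ≤ 1 / 2 →
      HasDerivAt (fun s : ℝ => (1 + s) ^ p) (p * (1 + t) ^ (p - 1)) t := fun p t ht => by
    simpa using ((hasDerivAt_id t).const_add 1).rpow_const (p := p) (Or.inl (hpos t ht).ne')
  obtain ⟨M, hM⟩ := (isCompact_closedBall (0 : ℝ) (1 / 2)).exists_bound_of_continuousOn
    (f := fun t : ℝ => α * ((α - 1) * ((α - 2) * (1 + t) ^ (α - 3)))) (by
      intro t ht
      have ht' : |t| ≤ 1 / 2 := by simpa [Real.dist_eq] using ht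
      exact ((hder (α - 3) t ht').continuousAt.const_mul _ |>.const_mul _
        |>.const_mul _).continuousWithinAt)
  have hM' : ∀ t : ℝ, |t| ≤ 1 / 2 →
      |α * ((α - 1) * ((α - 2) * (1 + t) ^ (α - 3)))| ≤ M := fun t ht => by
    simpa only [Real.norm_eq_abs] using hM t (by simpa [Real.dist_eq] using ht)
  have hM0 : 0 ≤ M := (abs_nonneg _).trans (hM' 0 (by norm_num))
  refine ⟨M, hM0, ?_⟩
  have h1 := abs_le_mul_abs_pow_succ_of_hasDerivAt (n := 0) (r := 1 / 2) (K := M)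
    (f := fun t : ℝ => α * ((α - 1) * ((1 + t) ^ (α - 2) - 1)))
    (f' := fun t : ℝ => α * ((α - 1) * ((α - 2) * (1 + t) ^ (α - 3))))
    (fun t ht => by
      have h := (((hder (α - 2) t ht).sub_const 1).const_mul (α - 1)).const_mul α
      rwa [show α - 2 - 1 = α - 3 by ring] at h)
    (by simp) hM0 (by simpa using hM')
  have h2 := abs_le_mul_abs_pow_succ_of_hasDerivAt (r := 1 / 2) (K := M)
    (f := fun t : ℝ => α * ((1 + t) ^ (α - 1) - 1 - (α - 1) * t))
    (fun t ht => by
      have h := (((hder (α - 1) t ht).sub_const 1).sub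
        ((hasDerivAt_id t).const_mul (α - 1))).const_mul α
      refine h.congr_deriv ?_
      rw [show α - 1 - 1 = α - 2 by ring]
      ring)
    (by simp) hM0 h1
  exact abs_le_mul_abs_pow_succ_of_hasDerivAt (r := 1 / 2) (K := M)
    (f := fun t : ℝ => (1 + t) ^ α - 1 - α * t - (α * (α - 1) / 2) * t ^ 2)
    (fun t ht => by
      have h := (((hder α t ht).sub_const 1).sub
        ((hasDerivAt_id t).const_mul α)).sub
        (((hasDerivAt_id t).pow 2).const_mul (α * (α - 1) / 2))
      refine h.congr_deriv ?_
      simp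
      ring)
    (by simp) hM0 h2

lemma rpow_sub_one_mul_self {x p : ℝ} (hx : 0 ≤ x) (hp : p ≠ 0) :
    x ^ (p - 1) * x = x ^ p := by
  have h := Real.rpow_add_natCast' (x := x) (y := p - 1) (n := 1) hx (by simpa using hp)
  simpa using h.symm

lemma rpow_sub_two_mul_sq {x p : ℝ} (hx : 0 ≤ x) (hp : p ≠ 0) :
    x ^ (p - 2) * x ^ 2 = x ^ p := by
  have h := Real.rpow_add_natCast' (x := x) (y := p - 2) (n := 2) hx (by simpa using hp)
  simpa using h.symm

lemma abs_taylor_remainder_le_of_le_two_mul {α a b : ℝ} (hα : 2 ≤ α) (ha : 0 ≤ a)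
    (hab : a ≤ 2 * |b|) :
    |(|a + b|) ^ (α - 1) * (a + b) - a ^ α - α * a ^ (α - 1) * b -
        (α * (α - 1) / 2) * a ^ (α - 2) * b ^ 2| ≤
      (3 ^ α + 2 ^ α + α * 2 ^ (α - 1) + α * (α - 1) / 2 * 2 ^ (α - 2)) * |b| ^ α := by
  have hb := abs_nonneg b
  have hα0 : α ≠ 0 := by linarith
  have e1 : |(|a + b|) ^ (α - 1) * (a + b)| ≤ 3 ^ α * |b| ^ α := by
    rw [abs_mul, abs_of_nonneg (by positivity : 0 ≤ |a + b| ^ (α - 1)),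
      rpow_sub_one_mul_self (abs_nonneg _) hα0, ← Real.mul_rpow (by norm_num) hb]
    refine Real.rpow_le_rpow (abs_nonneg _) ?_ (by linarith)
    have := abs_add_le a b
    rw [abs_of_nonneg ha] at this
    linarith
  have key : ∀ p : ℝ, 0 ≤ p → a ^ p ≤ 2 ^ p * |b| ^ p := fun p hp => by
    rw [← Real.mul_rpow (by norm_num) hb]
    exact Real.rpow_le_rpow ha hab hp
  have e2 : |a ^ α| ≤ 2 ^ α * |b| ^ α := by
    rw [abs_of_nonneg (by positivity)]
    exact key α (by linarith)
  have e3 : |α * a ^ (α - 1) * b| ≤ α * 2 ^ (α - 1) * |b| ^ α := by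
    rw [abs_mul, abs_of_nonneg (by positivity : 0 ≤ α * a ^ (α - 1)),
      ← rpow_sub_one_mul_self hb hα0]
    calc _ ≤ α * (2 ^ (α - 1) * |b| ^ (α - 1)) * |b| := by
          gcongr
          exact key _ (by linarith)
      _ = _ := by ring
  have hc : 0 ≤ α * (α - 1) / 2 := by nlinarith
  have e4 : |(α * (α - 1) / 2) * a ^ (α - 2) * b ^ 2| ≤
      α * (α - 1) / 2 * 2 ^ (α - 2) * |b| ^ α := by
    rw [abs_of_nonneg (by positivity), ← rpow_sub_two_mul_sq hb hα0, ← sq_abs b]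
    calc _ ≤ α * (α - 1) / 2 * (2 ^ (α - 2) * |b| ^ (α - 2)) * |b| ^ 2 := by
          gcongr
          exact key _ (by linarith)
      _ = _ := by ring
  rw [abs_le] at *
  constructor <;> linarith [e1.1, e1.2, e2.1, e2.2, e3.1, e3.2, e4.1, e4.2]

lemma abs_taylor_remainder_le_of_two_mul_lt {α K a b : ℝ} (hα : α ≠ 0) (hK0 : 0 ≤ K)
    (hK : ∀ t : ℝ, |t| ≤ 1 / 2 →
      |(1 + t) ^ α - 1 - α * t - (α * (α - 1) / 2) * t ^ 2| ≤ K * |t| ^ 3)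
    (hab : 2 * |b| < a) :
    |(|a + b|) ^ (α - 1) * (a + b) - a ^ α - α * a ^ (α - 1) * b -
        (α * (α - 1) / 2) * a ^ (α - 2) * b ^ 2| ≤
      K * (a ^ (max 0 (α - 3)) * |b| ^ (α - max 0 (α - 3))) := by
  have ha : 0 < a := by linarith [abs_nonneg b]
  obtain ⟨t, rfl⟩ : ∃ t, b = a * t := ⟨b / a, by field_simp⟩
  rw [abs_mul, abs_of_pos ha] at hab
  have ht : |t| ≤ 1 / 2 := by nlinarith
  have h1t : 0 < 1 + t := by linarith [(abs_le.1 ht).1]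
  have hsum : a + a * t = a * (1 + t) := by ring
  rw [hsum, abs_of_pos (by positivity : 0 < a * (1 + t)),
    rpow_sub_one_mul_self (by positivity) hα, Real.mul_rpow ha.le h1t.le]
  have e : a ^ α * (1 + t) ^ α - a ^ α - α * a ^ (α - 1) * (a * t) -
      α * (α - 1) / 2 * a ^ (α - 2) * (a * t) ^ 2 =
      a ^ α * ((1 + t) ^ α - 1 - α * t - (α * (α - 1) / 2) * t ^ 2) := by
    linear_combination (-α * t) * rpow_sub_one_mul_self ha.le hα -
      (α * (α - 1) / 2 * t ^ 2) * rpow_sub_two_mul_sq ha.le hα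
  rw [e, abs_mul, abs_of_pos (by positivity : 0 < a ^ α), abs_mul, abs_of_pos ha,
    Real.mul_rpow ha.le (abs_nonneg t), ← mul_assoc (a ^ _), ← Real.rpow_add ha,
    add_sub_cancel]
  have h3 : |t| ^ 3 ≤ |t| ^ (α - max 0 (α - 3)) := by
    rw [← Real.rpow_natCast]
    refine Real.rpow_le_rpow_of_exponent_ge_of_imp (abs_nonneg t) (by linarith) ?_ ?_
    · push_cast
      linarith [le_max_right 0 (α - 3)]
    · intro _ h
      norm_num at h
  calc _ ≤ a ^ α * (K * |t| ^ 3) := by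
        gcongr
        exact hK t ht
    _ ≤ a ^ α * (K * |t| ^ (α - max 0 (α - 3))) := by gcongr
    _ = _ := by ring

/-- Lemma A.1: Taylor-type inequality of second order for `s ↦ |s|^{α−1} s`, `α ≥ 2`. -/
theorem stmt6 (α : ℝ) (hα : 2 ≤ α) :
    ∃ C > 0, ∀ a b : ℝ, 0 ≤ a →
      |(|a + b|) ^ (α - 1) * (a + b) - a ^ α - α * a ^ (α - 1) * b -
          (α * (α - 1) / 2) * a ^ (α - 2) * b ^ 2| ≤
        C * (|b| ^ α + a ^ (max 0 (α - 3)) * |b| ^ (α - max 0 (α - 3))) := by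
  obtain ⟨K, hK0, hK⟩ := exists_abs_one_add_rpow_sub_taylor_le α
  set L : ℝ := 3 ^ α + 2 ^ α + α * 2 ^ (α - 1) + α * (α - 1) / 2 * 2 ^ (α - 2) with hL
  have hc : 0 ≤ α * (α - 1) / 2 := by nlinarith
  have hL0 : 0 < L := by positivity
  refine ⟨L + K, by positivity, fun a b ha => ?_⟩
  have hX : 0 ≤ |b| ^ α := by positivity
  have hY : 0 ≤ a ^ (max 0 (α - 3)) * |b| ^ (α - max 0 (α - 3)) := by positivity
  rcases le_or_gt a (2 * |b|) with hab | hab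
  · refine (abs_taylor_remainder_le_of_le_two_mul hα ha hab).trans ?_
    rw [← hL]
    gcongr <;> linarith
  · refine (abs_taylor_remainder_le_of_two_mul_lt (by linarith) hK0 hK hab).trans ?_
    gcongr <;> linarith
end
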